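/- arXiv:1407.7569 — 8 statements merged into one kernel-verified Lean document; each statement's English description precedes it below -/
import Mathlib

section
/- Let A be a subalgebra of the algebra of linear operators on the real vector space of polynomials, and let (p_n)_{n≥0} be a sequence of real polynomials with deg p_n = n which are eigenfunctions of an operator D_p ∈ A, say D_p(p_n) = θ_n p_n for all n ≥ 0. Let m ≥ 1 and for h = 1,…,m let (ε_n^h)_n and (σ_n^h)_n be sequences of real numbers, each given by a rational function of n, defining m D-operators D_1,…,D_m ∈ A for (p_n)_n and A. Let Y_1,…,Y_m be polynomials such that Ω(n) ≠ 0 for all n ≥ 0, where Ω(x) = det( ξ^l_{x−j,m−j} Y_l(θ_{x−j}) )_{l,j=1}^m. Define q_n(x) as the (m+1)×(m+1) determinant whose first row is (p_n(x), −p_{n−1}(x), …, (−1)^m p_{n−m}(x)) and whose (h+1)-th row, for h = 1,…,m, is (ξ^h_{n,m} Y_h(θ_n), ξ^h_{n−1,m−1} Y_h(θ_{n−1}), …, ξ^h_{n−m,0} Y_h(θ_{n−m})). Let S be a rational function, let λ_x be a function satisfying λ_x − λ_{x−1} = S(x)Ω(x), and for h = 1,…,m set M_h(x) = Σ_{j=1}^m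 (−1)^{h+j} ξ^h_{x,m−j} S(x+j) det( ξ^l_{x+j−r,m−r} Y_l(θ_{x+j−r}) )_{l∈{1,…,m}\{h}; r∈{1,…,m}\{j}}. Assume: (i) S(x)Ω(x) is a polynomial in x; (ii) there exist polynomials M̃_1,…,M̃_m with M_h(x) = σ^h_{x+1} M̃_h(θ_x) for h = 1,…,m; (iii) there exists a polynomial P_S with P_S(θ_x) = 2λ_x + Σ_{h=1}^m Y_h(θ_x) M_h(x). Then the operator D_{q,S} = (1/2) P_S(D_p) + Σ_{h=1}^m M̃_h(D_p)∘D_h∘Y_h(D_p) belongs to A and satisfies D_{q,S}(q_n) = λ_n q_n for all n ≥ 0. -/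
open Polynomial Finset

/-- Determinant of the minor of an `m × m` matrix obtained by deleting row `h`
and column `j` (keeping the order of the remaining rows and columns). -/
noncomputable def minorDet : (m : ℕ) → Matrix (Fin m) (Fin m) ℝ → Fin m → Fin m → ℝ
  | 0, _, h, _ => Fin.elim0 h
  | _ + 1, A, h, j => Matrix.det (A.submatrix h.succAbove j.succAbove)

/-- A sequence `f : ℤ → ℝ` is (the restriction of) a rational function of the variable. -/
def IsRationalSeq (f : ℤ → ℝ) : Prop :=
  ∃ u v : Polynomial ℝ, ∀ n : ℤ, v.eval (n : ℝ) ≠ 0 ∧ f n = u.eval (n : ℝ) / v.eval (n : ℝ)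

/-- The minor of the `m × (m + 1)` matrix `(g l (n - k) (m - k))` obtained by deleting column `k`,
extended by zero to `k > m`. -/
noncomputable def casoratiMinor {m : ℕ} (g : Fin m → ℤ → ℕ → ℝ) (n : ℤ) (k : ℕ) : ℝ :=
  if hk : k < m + 1 then
    Matrix.det (Matrix.of fun l c : Fin m => g l (n - (Fin.succAbove ⟨k, hk⟩ c : Fin (m + 1)))
      (m - (Fin.succAbove ⟨k, hk⟩ c : Fin (m + 1))))
  else 0

/-- The `m × m` Casorati matrix of `g` at `x`. -/
def casoratiMatrix {m : ℕ} (g : Fin m → ℤ → ℕ → ℝ) (x : ℤ) : Matrix (Fin m) (Fin m) ℝ :=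
  Matrix.of fun l j => g l (x - (j : ℤ) - 1) (m - (j : ℕ) - 1)

theorem casoratiMinor_of_lt {m : ℕ} (g : Fin m → ℤ → ℕ → ℝ) (n : ℤ) {k : ℕ} (hk : m < k) :
    casoratiMinor g n k = 0 :=
  dif_neg (by omega)

theorem neg_one_pow_mul_minorDet {m : ℕ} (B : Matrix (Fin m) (Fin m) ℝ) (h j : Fin m) :
    (-1 : ℝ) ^ ((h : ℕ) + (j : ℕ)) * minorDet m B h j = B.adjugate j h := by
  cases m with
  | zero => exact h.elim0
  | succ m => rw [minorDet, Matrix.adjugate_fin_succ_eq_det_submatrix]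

theorem sum_adjugate_mul {m : ℕ} (B : Matrix (Fin m) (Fin m) ℝ) (j : Fin m) (v : Fin m → ℝ) :
    ∑ h, B.adjugate j h * v h = (B.updateCol j v).det := by
  rw [← Matrix.cramer_apply, Matrix.cramer_eq_adjugate_mulVec]
  rfl

theorem aeval_apply_of_apply_eq_smul {V : Type*} [AddCommGroup V] [Module ℝ V]
    {D : Module.End ℝ V} {v : V} {t : ℝ} (hv : D v = t • v) (P : ℝ[X]) :
    aeval D P v = P.eval t • v := by
  induction P using Polynomial.induction_on' with
  | add P Q hP hQ => simp [hP, hQ, add_smul]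
  | monomial n a =>
    have hpow : (D ^ n) v = t ^ n • v := by
      induction n with
      | zero => simp
      | succ n ih => rw [pow_succ, Module.End.mul_apply, hv, map_smul, ih, smul_smul, pow_succ']
    simp [aeval_monomial, hpow, smul_smul, mul_comm]

/-- Laplace expansion of a determinant with first row `(u 0, -u 1, …, (-1) ^ m u m)`. -/
theorem det_cons_casorati {R : Type*} [CommRing R] {m : ℕ} (f : ℝ →+* R)
    (g : Fin m → ℤ → ℕ → ℝ) (n : ℤ) (u : ℕ → R) (U : Matrix (Fin (m + 1)) (Fin (m + 1)) R)
    (hX0 : ∀ k : Fin (m + 1), U 0 k = (-1) ^ (k : ℕ) * u k)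
    (hXs : ∀ l (k : Fin (m + 1)), U (Fin.succ l) k = f (g l (n - (k : ℤ)) (m - (k : ℕ)))) :
    U.det = ∑ k ∈ range (m + 1), f (casoratiMinor g n k) * u k := by
  rw [Matrix.det_succ_row_zero, Finset.sum_range]
  refine Finset.sum_congr rfl fun k _ => ?_
  have hsub : (U.submatrix Fin.succ k.succAbove).det = f (casoratiMinor g n k) := by
    rw [casoratiMinor, dif_pos k.isLt, RingHom.map_det]
    congr 1
    ext l c
    simp [hXs]
  have hsq : ((-1 : R) ^ (k : ℕ)) * (-1) ^ (k : ℕ) = 1 := by rw [← mul_pow]; simp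
  rw [hsub, hX0]
  linear_combination (u k * f (casoratiMinor g n k)) * hsq

theorem sum_neg_one_pow_mul_casoratiMinor {m : ℕ} (g : Fin m → ℤ → ℕ → ℝ) (n : ℤ) (l : Fin m) :
    ∑ k ∈ range (m + 1), (-1 : ℝ) ^ k * casoratiMinor g n k * g l (n - k) (m - k) = 0 := by
  let U : Matrix (Fin (m + 1)) (Fin (m + 1)) ℝ := Matrix.of
    (Fin.cons (fun k => g l (n - (k : ℤ)) (m - (k : ℕ)))
      (fun l' k => g l' (n - (k : ℤ)) (m - (k : ℕ))))
  have hdet : U.det = 0 :=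
    Matrix.det_zero_of_row_eq (Fin.succ_ne_zero l).symm (by ext k; simp [U])
  rw [det_cons_casorati (RingHom.id ℝ) g n (fun k => (-1) ^ k * g l (n - k) (m - k)) U
    (fun k => by simp [U, ← mul_assoc, ← mul_pow]) (fun l' k => by simp [U])] at hdet
  rw [← hdet]
  refine Finset.sum_congr rfl fun k _ => ?_
  simp only [RingHom.id_apply]
  ring

section Casorati

variable {m : ℕ} (g : Fin m → ℤ → ℕ → ℝ) (n : ℤ) (r : ℕ)

theorem det_updateCol_casoratiMatrix_eq_zero (j : Fin m) {k : ℕ} (h1 : r ≤ k + j)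
    (h2 : k + j < m + r) (hkr : k ≠ r) :
    ((casoratiMatrix g (n - r + j + 1)).updateCol j
      fun h => g h (n - k) (m + r - j - 1 - k)).det = 0 := by
  have hne : j ≠ ⟨k + j - r, by omega⟩ := by
    rw [Ne, Fin.ext_iff]
    simp only
    omega
  refine Matrix.det_zero_of_column_eq hne fun l => ?_
  rw [Matrix.updateCol_self, Matrix.updateCol_ne hne.symm]
  simp only [casoratiMatrix, Matrix.of_apply]
  congr 1 <;> omega

theorem updateCol_casoratiMatrix_self (j : Fin m) :
    ((casoratiMatrix g (n - r + j + 1)).updateCol j fun h => g h (n - r) (m + r - j - 1 - r)) =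
      casoratiMatrix g (n - r + j + 1) := by
  convert Matrix.updateCol_eq_self _ j using 2
  ext h
  simp only [casoratiMatrix, Matrix.of_apply]
  congr 1 <;> omega

variable {g} {ξ : Fin m → ℤ → ℕ → ℝ}
  (hg : ∀ l x i k, g l x (i + k) = g l x i * ξ l (x - i) k)

include hg in
theorem sum_casoratiMinor_mul_det_updateCol (hr : r ≤ m) (j : Fin m) :
    ∑ k ∈ range r, (-1 : ℝ) ^ (r - k + 1) * casoratiMinor g n k *
      ((casoratiMatrix g (n - r + j + 1)).updateCol j
        fun h => g h (n - k) (m + r - j - 1 - k)).det =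
    if (j : ℕ) < r then casoratiMinor g n r * (casoratiMatrix g (n - r + j + 1)).det else 0 := by
  split_ifs with hj
  · set d : ℕ → ℝ := fun k => ((casoratiMatrix g (n - r + j + 1)).updateCol j
        fun h => g h (n - k) (m + r - j - 1 - k)).det with hd
    have hall : ∑ k ∈ range (m + 1), (-1 : ℝ) ^ k * casoratiMinor g n k * d k = 0 := by
      have hterm : ∀ k ∈ range (m + 1), (-1 : ℝ) ^ k * casoratiMinor g n k * d k =
          ∑ h, (casoratiMatrix g (n - r + j + 1)).adjugate j h * ξ h (n - m) (r - j - 1) *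
            ((-1 : ℝ) ^ k * casoratiMinor g n k * g h (n - k) (m - k)) := by
        intro k hk
        have hk' : k ≤ m := by simpa [Nat.lt_succ_iff] using hk
        rw [hd]
        simp only
        rw [← sum_adjugate_mul, Finset.mul_sum]
        refine Finset.sum_congr rfl fun h _ => ?_
        rw [show m + r - j - 1 - k = (m - k) + (r - j - 1) by omega, hg,
          show n - (k : ℤ) - ((m - k : ℕ) : ℤ) = n - m by omega]
        ring
      rw [Finset.sum_congr rfl hterm, Finset.sum_comm]
      refine Finset.sum_eq_zero fun h _ => ?_
      rw [← Finset.mul_sum, sum_neg_one_pow_mul_casoratiMinor, mul_zero]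
    have htrunc : ∑ k ∈ range (r + 1), (-1 : ℝ) ^ k * casoratiMinor g n k * d k = 0 := by
      rw [← hall]
      refine Finset.sum_subset (by intro k; simp only [mem_range]; omega) fun k hk hk' => ?_
      simp only [mem_range] at hk hk'
      rw [hd]
      simp only
      rw [det_updateCol_casoratiMatrix_eq_zero g n r j (by omega) (by omega) (by omega), mul_zero]
    have hdr : d r = (casoratiMatrix g (n - r + j + 1)).det := by
      rw [hd]
      simp only
      rw [updateCol_casoratiMatrix_self]
    rw [Finset.sum_range_succ, hdr] at htrunc
    have hsign : ∀ k ∈ range r, (-1 : ℝ) ^ (r - k + 1) * casoratiMinor g n k * d k =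
        -(-1) ^ r * ((-1 : ℝ) ^ k * casoratiMinor g n k * d k) := by
      intro k hk
      have hk' : k < r := by simpa using hk
      have hpow : (-1 : ℝ) ^ (r - k + 1) = -(-1) ^ r * (-1) ^ k := by
        obtain ⟨t, rfl⟩ := Nat.exists_eq_add_of_lt hk'
        have hsq : ((-1 : ℝ) ^ k) * (-1) ^ k = 1 := by rw [← mul_pow]; simp
        rw [show k + t + 1 - k + 1 = t + 2 by omega]
        simp only [pow_add]
        linear_combination (-(-1 : ℝ) ^ t) * hsq
      rw [hpow]
      ring
    rw [Finset.sum_congr rfl hsign, ← Finset.mul_sum]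
    have hsq : ((-1 : ℝ) ^ r) * (-1) ^ r = 1 := by rw [← mul_pow]; simp
    linear_combination (-(-1 : ℝ) ^ r) * htrunc +
      (casoratiMinor g n r * (casoratiMatrix g (n - r + j + 1)).det) * hsq
  · refine Finset.sum_eq_zero fun k hk => ?_
    have hk' : k < r := by simpa using hk
    rw [det_updateCol_casoratiMatrix_eq_zero g n r j (by omega) (by omega) (by omega), mul_zero]

include hg in
theorem casoratiMinor_mul_sub_eq_sum
    {S Λ : ℤ → ℝ} (hΛ : ∀ x, Λ x - Λ (x - 1) = S x * (casoratiMatrix g x).det)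
    {M : Fin m → ℤ → ℝ}
    (hM : ∀ h (x : ℤ), M h x = ∑ j : Fin m, ξ h x (m - j - 1) * S (x + j + 1) *
      (casoratiMatrix g (x + j + 1)).adjugate j h) :
    casoratiMinor g n r * (Λ n - Λ (n - r)) =
      ∑ k ∈ range r, casoratiMinor g n k *
        ∑ h, (-1 : ℝ) ^ (r - k + 1) * g h (n - k) (r - k) * M h (n - r) := by
  rcases le_or_gt r m with hr | hr
  · have hrhs : ∑ k ∈ range r, casoratiMinor g n k *
          ∑ h, (-1 : ℝ) ^ (r - k + 1) * g h (n - k) (r - k) * M h (n - r) =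
        ∑ j : Fin m, S (n - r + j + 1) * ∑ k ∈ range r,
          (-1 : ℝ) ^ (r - k + 1) * casoratiMinor g n k *
            ((casoratiMatrix g (n - r + j + 1)).updateCol j
              fun h => g h (n - k) (m + r - j - 1 - k)).det := by
      simp_rw [Finset.mul_sum]
      rw [Finset.sum_comm]
      conv_rhs => rw [Finset.sum_comm]
      rw [Finset.sum_comm]
      refine Finset.sum_congr rfl fun k hk => ?_
      have hk' : k < r := by simpa using hk
      simp_rw [hM, ← sum_adjugate_mul, Finset.mul_sum]
      rw [Finset.sum_comm]
      refine Finset.sum_congr rfl fun j _ => Finset.sum_congr rfl fun h _ => ?_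
      rw [show m + r - j - 1 - k = (r - k) + (m - j - 1) by omega, hg,
        show n - (k : ℤ) - ((r - k : ℕ) : ℤ) = n - r by omega]
      ring
    rw [hrhs]
    simp_rw [sum_casoratiMinor_mul_det_updateCol n r hg hr]
    have htel : ∀ t : ℕ, ∑ j ∈ range t,
        S (n - r + j + 1) * (casoratiMatrix g (n - r + j + 1)).det =
          Λ (n - r + t) - Λ (n - r) := by
      intro t
      induction t with
      | zero => simp
      | succ t ih =>
        rw [Finset.sum_range_succ, ih, ← hΛ]
        push_cast
        rw [add_sub_cancel_right, ← add_assoc]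
        ring
    have hfin := Finset.sum_range (n := m) fun j : ℕ => S (n - r + j + 1) *
      if j < r then casoratiMinor g n r * (casoratiMatrix g (n - r + j + 1)).det else 0
    rw [← hfin, ← Finset.sum_subset (Finset.range_subset_range.2 hr)
      (fun j _ hj => by rw [if_neg (by simpa using hj), mul_zero])]
    have hsum := htel r
    rw [sub_add_cancel] at hsum
    rw [← hsum, Finset.mul_sum]
    refine Finset.sum_congr rfl fun j hj => ?_
    rw [if_pos (by simpa using hj)]
    ring
  · rw [casoratiMinor_of_lt g n hr, zero_mul, eq_comm,
      ← Finset.sum_subset (Finset.range_subset_range.2 hr)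
        (fun k _ hk => by rw [casoratiMinor_of_lt g n (by simpa using hk), zero_mul])]
    simp_rw [Finset.mul_sum]
    rw [Finset.sum_comm]
    refine Finset.sum_eq_zero fun h _ => ?_
    have hterm : ∀ k ∈ range (m + 1), casoratiMinor g n k *
        ((-1 : ℝ) ^ (r - k + 1) * g h (n - k) (r - k) * M h (n - r)) =
        ((-1 : ℝ) ^ (r + 1) * ξ h (n - m) (r - m) * M h (n - r)) *
          ((-1 : ℝ) ^ k * casoratiMinor g n k * g h (n - k) (m - k)) := by
      intro k hk
      have hk' : k ≤ m := by simpa [Nat.lt_succ_iff] using hk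
      have hpow : (-1 : ℝ) ^ (r - k + 1) = (-1) ^ (r + 1) * (-1) ^ k := by
        rw [← pow_add, show r + 1 + k = (r - k + 1) + 2 * k by omega, pow_add _ _ (2 * k), pow_mul]
        simp
      rw [hpow, show r - k = (m - k) + (r - m) by omega, hg,
        show n - (k : ℤ) - ((m - k : ℕ) : ℤ) = n - m by omega]
      ring
    rw [Finset.sum_congr rfl hterm, ← Finset.mul_sum, sum_neg_one_pow_mul_casoratiMinor, mul_zero]

end Casorati

/-- Theorem 3.1: given `𝒟`-operators `𝒟_1,…,𝒟_m ∈ 𝒜` for `(p_n)_n` and polynomials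
`Y_1,…,Y_m` with nonvanishing Casorati determinant `Ω`, under the hypotheses
(i) `S·Ω` is a polynomial, (ii) `M_h(x) = σ^h_{x+1} M̃_h(θ_x)` with `M̃_h` polynomials, and
(iii) `P_S(θ_x) = 2λ_x + Σ_h Y_h(θ_x)M_h(x)` for a polynomial `P_S`, the operator
`D_{q,S} = (1/2)P_S(D_p) + Σ_h M̃_h(D_p)𝒟_h Y_h(D_p)` belongs to `𝒜` and satisfies
`D_{q,S}(q_n) = λ_n q_n` for all `n ≥ 0`. -/
theorem Dq_eigenfunctions
    (A : Subalgebra ℝ (Module.End ℝ (Polynomial ℝ)))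
    (m : ℕ) (hm : 1 ≤ m)
    (p : ℤ → Polynomial ℝ)
    (hpdeg : ∀ n : ℕ, (p (n : ℤ)).natDegree = n ∧ p (n : ℤ) ≠ 0)
    (hpneg : ∀ n : ℤ, n < 0 → p n = 0)
    (Dp : Module.End ℝ (Polynomial ℝ)) (hDpA : Dp ∈ A)
    (θ : ℤ → ℝ)
    (hDp : ∀ n : ℕ, Dp (p (n : ℤ)) = θ (n : ℤ) • p (n : ℤ))
    (ε σ : Fin m → ℤ → ℝ)
    (hεrat : ∀ h, IsRationalSeq (ε h)) (hσrat : ∀ h, IsRationalSeq (σ h))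
    -- the `m` 𝒟-operators
    (Dop : Fin m → Module.End ℝ (Polynomial ℝ))
    (hDopA : ∀ h, Dop h ∈ A)
    (hDop : ∀ h, ∀ n : ℕ, Dop h (p (n : ℤ)) =
      (-(1 / 2 : ℝ) * σ h ((n : ℤ) + 1)) • p (n : ℤ)
        + ∑ j ∈ Finset.Icc 1 n,
            ((-1 : ℝ) ^ (j + 1) * σ h ((n : ℤ) - (j : ℤ) + 1) *
              ∏ i ∈ Finset.range j, ε h ((n : ℤ) - (i : ℤ))) • p ((n : ℤ) - (j : ℤ)))
    -- the auxiliary functions ξ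
    (ξ : Fin m → ℤ → ℕ → ℝ)
    (hξ : ∀ h x i, ξ h x i = ∏ j ∈ Finset.range i, ε h (x - (j : ℤ)))
    -- the polynomials Y and the Casorati determinant Ω
    (Y : Fin m → Polynomial ℝ)
    (Ω : ℤ → ℝ)
    (hΩ : ∀ x : ℤ, Ω x = Matrix.det (Matrix.of fun l j : Fin m =>
      ξ l (x - (j : ℤ) - 1) (m - (j : ℕ) - 1) * (Y l).eval (θ (x - (j : ℤ) - 1))))
    (hΩne : ∀ n : ℕ, Ω (n : ℤ) ≠ 0)
    -- the polynomials q_n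
    (q : ℤ → Polynomial ℝ)
    (hq : ∀ n : ℤ, q n = Matrix.det (Matrix.of fun i k : Fin (m + 1) =>
      if hi : i = 0 then (-1 : Polynomial ℝ) ^ (k : ℕ) * p (n - (k : ℤ))
      else Polynomial.C (ξ (i.pred hi) (n - (k : ℤ)) (m - (k : ℕ)) *
        (Y (i.pred hi)).eval (θ (n - (k : ℤ))))))
    -- the rational function S and the function λ
    (S : ℤ → ℝ) (hSrat : IsRationalSeq S)
    (Λ : ℤ → ℝ)
    (hΛ : ∀ x : ℤ, Λ x - Λ (x - 1) = S x * Ω x)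
    -- the functions M_h
    (M : Fin m → ℤ → ℝ)
    (hM : ∀ h (x : ℤ), M h x = ∑ j : Fin m,
      (-1 : ℝ) ^ ((h : ℕ) + (j : ℕ)) * ξ h x (m - (j : ℕ) - 1) * S (x + (j : ℤ) + 1) *
        minorDet m (Matrix.of fun l r : Fin m =>
          ξ l (x + (j : ℤ) - (r : ℤ)) (m - (r : ℕ) - 1) * (Y l).eval (θ (x + (j : ℤ) - (r : ℤ)))) h j)
    -- hypothesis (i): S·Ω is a polynomial in x
    (hSΩ : ∃ W : Polynomial ℝ, ∀ x : ℤ, S x * Ω x = W.eval (x : ℝ))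
    -- hypothesis (ii): M_h(x) = σ^h_{x+1} M̃_h(θ_x) with M̃_h polynomials
    (Mt : Fin m → Polynomial ℝ)
    (hMt : ∀ h (x : ℤ), M h x = σ h (x + 1) * (Mt h).eval (θ x))
    -- hypothesis (iii): P_S(θ_x) = 2λ_x + Σ_h Y_h(θ_x) M_h(x)
    (PS : Polynomial ℝ)
    (hPS : ∀ x : ℤ, PS.eval (θ x) = 2 * Λ x + ∑ h : Fin m, (Y h).eval (θ x) * M h x) :
    ((1 / 2 : ℝ) • (Polynomial.aeval Dp PS)
        + ∑ h : Fin m, (Polynomial.aeval Dp (Mt h)) * Dop h * (Polynomial.aeval Dp (Y h))) ∈ A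
      ∧ ∀ n : ℕ,
          ((1 / 2 : ℝ) • (Polynomial.aeval Dp PS)
            + ∑ h : Fin m, (Polynomial.aeval Dp (Mt h)) * Dop h * (Polynomial.aeval Dp (Y h)))
            (q (n : ℤ))
          = Λ (n : ℤ) • q (n : ℤ) := by
  have hξadd : ∀ l x i k, ξ l x (i + k) = ξ l x i * ξ l (x - i) k := by
    intro l x i k
    simp only [hξ, Finset.prod_range_add]
    congr 1
    refine Finset.prod_congr rfl fun j _ => ?_
    congr 1
    push_cast
    ring
  set g : Fin m → ℤ → ℕ → ℝ := fun l x i => ξ l x i * (Y l).eval (θ x) with hgdef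
  have hg : ∀ l x i k, g l x (i + k) = g l x i * ξ l (x - i) k := by
    intro l x i k
    simp only [hgdef, hξadd]
    ring
  have hΛ' : ∀ x, Λ x - Λ (x - 1) = S x * (casoratiMatrix g x).det := fun x => by
    rw [hΛ, hΩ]
    rfl
  have hM' : ∀ h (x : ℤ), M h x = ∑ j : Fin m, ξ h x (m - j - 1) * S (x + j + 1) *
      (casoratiMatrix g (x + j + 1)).adjugate j h := by
    intro h x
    rw [hM]
    refine Finset.sum_congr rfl fun j _ => ?_
    rw [← neg_one_pow_mul_minorDet]
    have hB : (Matrix.of fun l r : Fin m => ξ l (x + (j : ℤ) - (r : ℤ)) (m - (r : ℕ) - 1) *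
        (Y l).eval (θ (x + (j : ℤ) - (r : ℤ)))) = casoratiMatrix g (x + j + 1) := by
      ext l r
      simp only [casoratiMatrix, Matrix.of_apply, hgdef]
      rw [show x + (j : ℤ) + 1 - r - 1 = x + j - r by ring]
    rw [hB]
    ring
  have hq' : ∀ n : ℕ, ∀ N, m < N →
      q n = ∑ k ∈ range N, casoratiMinor g n k • p ((n : ℤ) - k) := by
    intro n N hN
    rw [hq, det_cons_casorati (C : ℝ →+* ℝ[X]) g n (fun k => p ((n : ℤ) - k)) _
      (fun k => by simp) (fun l k => by simp [Fin.succ_ne_zero, hgdef])]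
    simp_rw [← smul_eq_C_mul]
    exact Finset.sum_subset (Finset.range_subset_range.2 hN) fun k _ hk => by
      rw [casoratiMinor_of_lt g n (by simpa using hk), zero_smul]
  have hev : ∀ (P : ℝ[X]) (x : ℤ), aeval Dp P (p x) = P.eval (θ x) • p x := by
    intro P x
    refine aeval_apply_of_apply_eq_smul ?_ P
    rcases lt_or_ge x 0 with hx | hx
    · rw [hpneg x hx, map_zero, smul_zero]
    · lift x to ℕ using hx
      exact hDp x
  have hmem : ∀ P : ℝ[X], aeval Dp P ∈ A := fun P =>
    Algebra.adjoin_le (Set.singleton_subset_iff.2 hDpA) (aeval_mem_adjoin_singleton ℝ Dp)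
  refine ⟨A.add_mem (A.smul_mem (hmem _) _) (A.sum_mem fun h _ =>
    A.mul_mem (A.mul_mem (hmem _) (hDopA h)) (hmem _)), ?_⟩
  set L : Module.End ℝ ℝ[X] := (1 / 2 : ℝ) • (Polynomial.aeval Dp PS)
    + ∑ h : Fin m, (Polynomial.aeval Dp (Mt h)) * Dop h * (Polynomial.aeval Dp (Y h)) with hLdef
  have hLnat : ∀ x : ℕ, L (p x) = Λ x • p x + ∑ j ∈ Icc 1 x,
      (∑ h, (-1 : ℝ) ^ (j + 1) * g h x j * M h (x - j)) • p ((x : ℤ) - j) := by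
    intro x
    have hterm : ∀ h, (aeval Dp (Mt h) * Dop h * aeval Dp (Y h)) (p x) =
        (-(1 / 2 : ℝ) * ((Y h).eval (θ x) * M h x)) • p x + ∑ j ∈ Icc 1 x,
          ((-1 : ℝ) ^ (j + 1) * g h x j * M h (x - j)) • p ((x : ℤ) - j) := by
      intro h
      simp only [Module.End.mul_apply, hev, map_smul, hDop, map_add, map_sum, smul_add,
        Finset.smul_sum, smul_smul]
      congr 1
      · congr 1
        rw [hMt]
        ring
      · refine Finset.sum_congr rfl fun j _ => ?_
        congr 1
        rw [hMt, hgdef]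
        simp only [hξ]
        ring
    rw [hLdef]
    simp only [LinearMap.add_apply, LinearMap.smul_apply, LinearMap.sum_apply, hterm, hev,
      Finset.sum_add_distrib, smul_smul, hPS, Finset.sum_smul]
    rw [Finset.sum_comm, ← add_assoc, ← Finset.sum_smul, ← add_smul, ← Finset.mul_sum]
    congr 2
    ring
  have hL : ∀ n N k : ℕ, n < N → L (p ((n : ℤ) - k)) = Λ (n - k) • p ((n : ℤ) - k) +
      ∑ r ∈ range N, if k < r then
        (∑ h, (-1 : ℝ) ^ (r - k + 1) * g h (n - k) (r - k) * M h (n - r)) • p ((n : ℤ) - r)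
      else 0 := by
    intro n N k hN
    rcases lt_or_ge n k with hk | hk
    · rw [hpneg _ (by omega), map_zero, smul_zero, zero_add, Finset.sum_eq_zero]
      intro r _
      split_ifs with hr
      · rw [hpneg _ (by omega), smul_zero]
      · rfl
    · obtain ⟨x, rfl⟩ := Nat.exists_eq_add_of_le hk
      have hx : ((k + x : ℕ) : ℤ) - k = x := by push_cast; ring
      rw [hx, hLnat, ← Finset.sum_filter]
      congr 1
      rw [← Finset.sum_subset (s₁ := (Icc 1 x).map (addLeftEmbedding k))
        (s₂ := (range N).filter (k < ·)), Finset.sum_map]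
      · refine Finset.sum_congr rfl fun j _ => ?_
        have hxj : ((k + x : ℕ) : ℤ) - ((k + j : ℕ) : ℤ) = x - j := by push_cast; ring
        simp only [addLeftEmbedding_apply, hxj, Nat.add_sub_cancel_left]
      · intro r
        simp only [mem_map, mem_Icc, addLeftEmbedding_apply, mem_filter, mem_range]
        rintro ⟨j, hj, rfl⟩
        omega
      · intro r hr hrx
        simp only [mem_map, mem_Icc, addLeftEmbedding_apply, mem_filter, mem_range,
          not_exists, not_and] at hr hrx
        have hr' : k + x < r := by
          by_contra hcon
          exact hrx (r - k) (by omega) (by omega)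
        rw [hpneg _ (by omega), smul_zero]
  intro n
  have hnN : n < n + m + 1 := by omega
  rw [hq' n (n + m + 1) (by omega), map_sum, Finset.smul_sum]
  simp only [map_smul, hL n _ _ hnN, smul_add, Finset.sum_add_distrib, Finset.smul_sum]
  rw [Finset.sum_comm, ← Finset.sum_add_distrib]
  refine Finset.sum_congr rfl fun r hr => ?_
  have hmain := casoratiMinor_mul_sub_eq_sum n r hg hΛ' hM'
  have hsum : ∑ k ∈ range (n + m + 1), (casoratiMinor g n k • if k < r then
        (∑ h, (-1 : ℝ) ^ (r - k + 1) * g h (n - k) (r - k) * M h (n - r)) • p ((n : ℤ) - r)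
      else 0) = (casoratiMinor g n r * (Λ n - Λ (n - r))) • p ((n : ℤ) - r) := by
    rw [hmain, Finset.sum_smul]
    simp only [smul_ite, smul_zero, smul_smul]
    rw [← Finset.sum_filter]
    refine Finset.sum_congr ?_ fun _ _ => rfl
    ext k
    simp only [mem_filter, mem_range] at hr ⊢
    omega
  rw [hsum, smul_smul, smul_smul, ← add_smul]
  congr 1
  ring
end

section
/- In the setting and under the hypotheses of the main abstract theorem (Theorem 3.1), the polynomial P_S satisfying P_S(θ_x) = 2λ_x + Σ_{h=1}^m Y_h(θ_x) M_h(x) also satisfies the identity P_S(θ_x) − P_S(θ_{x−1}) = S(x)Ω(x) + S(x+m)Ω(x+m) for all x. -/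
open Polynomial Finset

/-- Laplace expansion of a determinant along column `j`, in terms of `minorDet`. -/
theorem det_eq_sum_minorDet {m : ℕ} (A : Matrix (Fin m) (Fin m) ℝ) (j : Fin m) :
    A.det = ∑ h : Fin m, (-1 : ℝ) ^ ((h : ℕ) + (j : ℕ)) * A h j * minorDet m A h j := by
  cases m with
  | zero => exact j.elim0
  | succ n => exact Matrix.det_succ_column A j

/-- In the setting of Theorem 3.1, the polynomial `P_S` also satisfies
`P_S(θ_x) − P_S(θ_{x−1}) = S(x)Ω(x) + S(x+m)Ω(x+m)`. -/
theorem PS_difference_identity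
    (A : Subalgebra ℝ (Module.End ℝ (Polynomial ℝ)))
    (m : ℕ) (hm : 1 ≤ m)
    (p : ℤ → Polynomial ℝ)
    (hpdeg : ∀ n : ℕ, (p (n : ℤ)).natDegree = n ∧ p (n : ℤ) ≠ 0)
    (hpneg : ∀ n : ℤ, n < 0 → p n = 0)
    (Dp : Module.End ℝ (Polynomial ℝ)) (hDpA : Dp ∈ A)
    (θ : ℤ → ℝ)
    (hDp : ∀ n : ℕ, Dp (p (n : ℤ)) = θ (n : ℤ) • p (n : ℤ))
    (ε σ : Fin m → ℤ → ℝ)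
    (hεrat : ∀ h, IsRationalSeq (ε h)) (hσrat : ∀ h, IsRationalSeq (σ h))
    -- the `m` 𝒟-operators
    (Dop : Fin m → Module.End ℝ (Polynomial ℝ))
    (hDopA : ∀ h, Dop h ∈ A)
    (hDop : ∀ h, ∀ n : ℕ, Dop h (p (n : ℤ)) =
      (-(1 / 2 : ℝ) * σ h ((n : ℤ) + 1)) • p (n : ℤ)
        + ∑ j ∈ Finset.Icc 1 n,
            ((-1 : ℝ) ^ (j + 1) * σ h ((n : ℤ) - (j : ℤ) + 1) *
              ∏ i ∈ Finset.range j, ε h ((n : ℤ) - (i : ℤ))) • p ((n : ℤ) - (j : ℤ)))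
    -- the auxiliary functions ξ
    (ξ : Fin m → ℤ → ℕ → ℝ)
    (hξ : ∀ h x i, ξ h x i = ∏ j ∈ Finset.range i, ε h (x - (j : ℤ)))
    -- the polynomials Y and the Casorati determinant Ω
    (Y : Fin m → Polynomial ℝ)
    (Ω : ℤ → ℝ)
    (hΩ : ∀ x : ℤ, Ω x = Matrix.det (Matrix.of fun l j : Fin m =>
      ξ l (x - (j : ℤ) - 1) (m - (j : ℕ) - 1) * (Y l).eval (θ (x - (j : ℤ) - 1))))
    (hΩne : ∀ n : ℕ, Ω (n : ℤ) ≠ 0)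
    -- the polynomials q_n
    (q : ℤ → Polynomial ℝ)
    (hq : ∀ n : ℤ, q n = Matrix.det (Matrix.of fun i k : Fin (m + 1) =>
      if hi : i = 0 then (-1 : Polynomial ℝ) ^ (k : ℕ) * p (n - (k : ℤ))
      else Polynomial.C (ξ (i.pred hi) (n - (k : ℤ)) (m - (k : ℕ)) *
        (Y (i.pred hi)).eval (θ (n - (k : ℤ))))))
    -- the rational function S and the function λ
    (S : ℤ → ℝ) (hSrat : IsRationalSeq S)
    (Λ : ℤ → ℝ)
    (hΛ : ∀ x : ℤ, Λ x - Λ (x - 1) = S x * Ω x)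
    -- the functions M_h
    (M : Fin m → ℤ → ℝ)
    (hM : ∀ h (x : ℤ), M h x = ∑ j : Fin m,
      (-1 : ℝ) ^ ((h : ℕ) + (j : ℕ)) * ξ h x (m - (j : ℕ) - 1) * S (x + (j : ℤ) + 1) *
        minorDet m (Matrix.of fun l r : Fin m =>
          ξ l (x + (j : ℤ) - (r : ℤ)) (m - (r : ℕ) - 1) * (Y l).eval (θ (x + (j : ℤ) - (r : ℤ)))) h j)
    -- hypothesis (i): S·Ω is a polynomial in x
    (hSΩ : ∃ W : Polynomial ℝ, ∀ x : ℤ, S x * Ω x = W.eval (x : ℝ))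
    -- hypothesis (ii): M_h(x) = σ^h_{x+1} M̃_h(θ_x) with M̃_h polynomials
    (Mt : Fin m → Polynomial ℝ)
    (hMt : ∀ h (x : ℤ), M h x = σ h (x + 1) * (Mt h).eval (θ x))
    -- hypothesis (iii): P_S(θ_x) = 2λ_x + Σ_h Y_h(θ_x) M_h(x)
    (PS : Polynomial ℝ)
    (hPS : ∀ x : ℤ, PS.eval (θ x) = 2 * Λ x + ∑ h : Fin m, (Y h).eval (θ x) * M h x) :
    ∀ x : ℤ, PS.eval (θ x) - PS.eval (θ (x - 1)) = S x * Ω x + S (x + (m : ℤ)) * Ω (x + (m : ℤ)) := by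
  have hsum : ∀ x : ℤ, ∑ h : Fin m, (Y h).eval (θ x) * M h x
      = ∑ j ∈ range m, S (x + (j : ℤ) + 1) * Ω (x + (j : ℤ) + 1) := by
    intro x
    rw [← Fin.sum_univ_eq_sum_range (fun j : ℕ => S (x + (j : ℤ) + 1) * Ω (x + (j : ℤ) + 1))]
    simp_rw [hM, mul_sum]
    rw [sum_comm]
    refine sum_congr rfl fun j _ => ?_
    have hmat : (Matrix.of fun l r : Fin m => ξ l (x + (j : ℤ) + 1 - (r : ℤ) - 1)
          (m - (r : ℕ) - 1) * (Y l).eval (θ (x + (j : ℤ) + 1 - (r : ℤ) - 1)))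
        = Matrix.of fun l r : Fin m => ξ l (x + (j : ℤ) - (r : ℤ)) (m - (r : ℕ) - 1) *
          (Y l).eval (θ (x + (j : ℤ) - (r : ℤ))) := by
      ext l r
      have hshift : x + (j : ℤ) + 1 - (r : ℤ) - 1 = x + (j : ℤ) - (r : ℤ) := by ring
      simp only [Matrix.of_apply, hshift]
    rw [hΩ, hmat, det_eq_sum_minorDet _ j, mul_sum]
    refine sum_congr rfl fun h _ => ?_
    simp only [Matrix.of_apply, add_sub_cancel_right]
    ring
  intro x
  have htel := sum_range_sub (fun j : ℕ => S (x + (j : ℤ)) * Ω (x + (j : ℤ))) m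
  have hshift : ∀ j : ℕ, x - 1 + (j : ℤ) + 1 = x + (j : ℤ) := fun j => by ring
  rw [hPS, hPS, hsum, hsum]
  simp only [hshift]
  rw [sum_sub_distrib] at htel
  simp only [Nat.cast_add, Nat.cast_one, Nat.cast_zero, add_zero, ← add_assoc] at htel
  linarith [hΛ x]
end

section
/- In the setting of the main abstract theorem (Theorem 3.1), for h, j = 1,…,m set Ψ_j^h(x) = ξ^h_{x−j,m−j} S(x) det( ξ^l_{x−r,m−r} Y_l(θ_{x−r}) )_{l∈{1,…,m}\{h}; r∈{1,…,m}\{j}}, and let Ω_g^h denote the determinant Ω when Y_h is replaced by the monomial x^g. Assume that θ_x is a polynomial in x of degree 2 and that every Ψ_j^h is a polynomial in x, and set d̃ = max{deg Ψ_j^h : h, j = 1,…,m}. Then each M_h and each S·Ω_g^h (h = 1,…,m; g = 0,1,2,…) is a polynomial in x. If, in addition, the degree of S·Ω_g^h is at most 2g + deg(S·Ω_0^h) for every h = 1,…,m and every g ≤ d̃ − deg(S·Ω_0^h), then M_h is a polynomial of degree at most deg(S·Ω_0^h). -/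
open Polynomial Finset

/-- The `m × m` Casorati determinant
`Ω(x) = det( ξ^l_{x−j,m−j} Y_l(θ_{x−j}) )_{l,j=1}^m` as a function of the family `Y`. -/
noncomputable def OmegaDet (m : ℕ) (ξ : Fin m → ℤ → ℕ → ℝ) (θ : ℤ → ℝ)
    (Y : Fin m → Polynomial ℝ) (x : ℤ) : ℝ :=
  Matrix.det (Matrix.of fun l j : Fin m =>
    ξ l (x - (j : ℤ) - 1) (m - (j : ℕ) - 1) * (Y l).eval (θ (x - (j : ℤ) - 1)))

/-- If the power moments `∑ j, (c j) ^ s * F j` have degree at most `d + s`, then the sum of the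
shifted polynomials `F j (x + c j)` has degree at most `d`. -/
theorem natDegree_sum_taylor_le {ι : Type*} [Fintype ι] (c : ι → ℝ) (F : ι → ℝ[X]) (d : ℕ)
    (hV : ∀ s, (∑ j, C (c j ^ s) * F j).natDegree ≤ d + s) :
    (∑ j, taylor (c j) (F j)).natDegree ≤ d := by
  rw [natDegree_le_iff_coeff_eq_zero]
  intro n hn
  obtain ⟨D, hD⟩ : ∃ D, ∀ j, (F j).natDegree < D :=
    ⟨(univ.sup fun j => (F j).natDegree) + 1, fun j =>
      Nat.lt_succ_of_le (le_sup (f := fun j => (F j).natDegree) (mem_univ j))⟩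
  have hcoeff : ∀ j, (taylor (c j) (F j)).coeff n
      = ∑ i ∈ range D, (i.choose n : ℝ) * (c j ^ (i - n) * (F j).coeff i) := by
    intro j
    rw [taylor_coeff, hasseDeriv_apply, sum_over_range' _ _ D (hD j), eval_finsetSum]
    · refine sum_congr rfl fun i _ => ?_
      rw [eval_monomial]
      ring
    · simp
  rw [finsetSum_coeff, sum_congr rfl fun j _ => hcoeff j, sum_comm]
  refine sum_eq_zero fun i _ => ?_
  rw [← mul_sum]
  rcases lt_or_ge i n with h | h
  · simp [Nat.choose_eq_zero_of_lt h]
  · have := coeff_eq_zero_of_natDegree_lt (lt_of_le_of_lt (hV (i - n)) (by omega : _ < i))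
    simp only [finsetSum_coeff, coeff_C_mul] at this
    rw [this, mul_zero]

/-- Shifting a quadratic polynomial by `-c`. -/
theorem quadratic_comp_X_sub_C (Θ : ℝ[X]) (hΘ : Θ.natDegree = 2) (c : ℝ) :
    Θ.comp (X - C c)
      = C c * (C (Θ.coeff 2) * C c - (C (2 * Θ.coeff 2) * X + C (Θ.coeff 1))) + Θ := by
  have h : Θ = C (Θ.coeff 2) * X ^ 2 + C (Θ.coeff 1) * X + C (Θ.coeff 0) := by
    conv_lhs => rw [as_sum_range_C_mul_X_pow Θ, hΘ]
    simp only [sum_range_succ, sum_range_zero]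
    ring
  set a := Θ.coeff 2
  set b := Θ.coeff 1
  rw [h]
  simp only [add_comp, mul_comp, C_comp, X_comp, pow_comp, map_mul, map_ofNat]
  ring

/-- Degree bounds on the sums `∑ j, Θ (x - c j) ^ g * F j x`, with `Θ` quadratic, give degree
bounds on the power moments `∑ j, (c j) ^ s * F j`. -/
theorem natDegree_moment_le {ι : Type*} [Fintype ι] (Θ : ℝ[X]) (hΘ : Θ.natDegree = 2)
    (c : ι → ℝ) (F : ι → ℝ[X]) (d N : ℕ) (hF : ∀ j, (F j).natDegree ≤ d + N)
    (hW : ∀ g ≤ N, (∑ j, Θ.comp (X - C (c j)) ^ g * F j).natDegree ≤ 2 * g + d) (s : ℕ) :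
    (∑ j, C (c j ^ s) * F j).natDegree ≤ d + s := by
  have ha : Θ.coeff 2 ≠ 0 := by
    rw [← hΘ]
    exact leadingCoeff_ne_zero.mpr (by rintro rfl; simp at hΘ)
  set a := Θ.coeff 2 with ha_def
  set b := Θ.coeff 1 with hb_def
  set L : ℝ[X] := C (2 * a) * X + C b with hL
  have hLdeg : L.natDegree = 1 := natDegree_linear (by simpa using ha)
  set V : ℕ → ℝ[X] := fun s => ∑ j, C (c j ^ s) * F j with hVdef
  have hVN : ∀ s, (V s).natDegree ≤ d + N := fun s =>
    natDegree_sum_le_of_forall_le _ _ fun j _ => (natDegree_C_mul_le _ _).trans (hF j)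
  have hU : ∀ g ≤ N,
      (∑ j, (Θ.comp (X - C (c j)) - Θ) ^ g * F j).natDegree ≤ 2 * g + d := by
    intro g hg
    have : ∑ j, (Θ.comp (X - C (c j)) - Θ) ^ g * F j
        = ∑ i ∈ range (g + 1), ((-Θ) ^ (g - i) * C (g.choose i : ℝ))
            * ∑ j, Θ.comp (X - C (c j)) ^ i * F j := by
      simp_rw [mul_sum]
      rw [sum_comm]
      refine sum_congr rfl fun j _ => ?_
      rw [sub_eq_add_neg, add_pow, sum_mul]
      refine sum_congr rfl fun i _ => ?_
      rw [← C_eq_natCast]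
      ring
    rw [this]
    refine natDegree_sum_le_of_forall_le _ _ fun i hi => ?_
    have hi' : i ≤ g := Nat.lt_succ_iff.mp (mem_range.mp hi)
    have h1 : ((-Θ) ^ (g - i) * C (g.choose i : ℝ)).natDegree ≤ (g - i) * 2 :=
      (natDegree_mul_C_le _ _).trans (natDegree_pow_le.trans (by rw [natDegree_neg, hΘ]))
    have h2 := hW i (hi'.trans hg)
    refine natDegree_mul_le.trans ?_
    omega
  have hexp : ∀ g, ∑ j, (Θ.comp (X - C (c j)) - Θ) ^ g * F j
      = ∑ i ∈ range (g + 1), (C (a ^ i * g.choose i) * (-L) ^ (g - i)) * V (g + i) := by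
    intro g
    simp_rw [hVdef, mul_sum]
    rw [sum_comm]
    refine sum_congr rfl fun j _ => ?_
    rw [quadratic_comp_X_sub_C Θ hΘ, add_sub_cancel_right, mul_pow, sub_eq_add_neg, add_pow,
      mul_sum, sum_mul]
    refine sum_congr rfl fun i _ => ?_
    simp only [map_mul, map_pow, C_eq_natCast, hL, ha_def, hb_def]
    ring
  have main : ∀ k s, N ≤ s + k → (V s).natDegree ≤ d + s := by
    intro k
    induction k with
    | zero => exact fun s hs => (hVN s).trans (by omega)
    | succ k ih =>
      intro g hg
      rcases Nat.lt_or_ge N g with hgN | hgN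
      · exact (hVN g).trans (by omega)
      have h0 : (-L) ^ g * V g = ∑ j, (Θ.comp (X - C (c j)) - Θ) ^ g * F j
          - ∑ i ∈ range g,
            (C (a ^ (i + 1) * g.choose (i + 1)) * (-L) ^ (g - (i + 1))) * V (g + (i + 1)) := by
        rw [hexp, sum_range_succ']
        simp
      have h1 : (∑ i ∈ range g, (C (a ^ (i + 1) * g.choose (i + 1)) * (-L) ^ (g - (i + 1)))
          * V (g + (i + 1))).natDegree ≤ 2 * g + d := by
        refine natDegree_sum_le_of_forall_le _ _ fun i hi => ?_
        have hi' := mem_range.mp hi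
        have h2 := ih (g + (i + 1)) (by omega)
        have h3 : (C (a ^ (i + 1) * g.choose (i + 1)) * (-L) ^ (g - (i + 1))).natDegree
            ≤ (g - (i + 1)) * 1 :=
          (natDegree_C_mul_le _ _).trans (natDegree_pow_le.trans (by rw [natDegree_neg, hLdeg]))
        refine natDegree_mul_le.trans ?_
        omega
      have h2 : ((-L) ^ g * V g).natDegree ≤ 2 * g + d := by
        rw [h0]
        exact (natDegree_sub_le _ _).trans (max_le (hU g hgN) h1)
      by_cases hV0 : V g = 0
      · simp [hV0]
      have hL0 : -L ≠ 0 := by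
        intro h
        rw [neg_eq_zero] at h
        simp [h] at hLdeg
      rw [natDegree_mul (pow_ne_zero _ hL0) hV0, natDegree_pow, natDegree_neg, hLdeg] at h2
      omega
  exact main N s (by omega)

/-- Lemma 3.2: in the setting of Theorem 3.1, if `θ_x` is a polynomial of degree 2 in `x`
and all the `Ψ_j^h` are polynomials with maximal degree `d̃`, then the `M_h` and the
`S·Ω_g^h` are polynomials; if moreover `deg(S·Ω_g^h) ≤ 2g + deg(S·Ω_0^h)` for all
`g ≤ d̃ − deg(S·Ω_0^h)`, then `M_h` has degree at most `deg(S·Ω_0^h)`. -/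
theorem M_h_polynomial_degree_bound
    (m : ℕ) (hm : 1 ≤ m)
    (θ : ℤ → ℝ)
    (Θ : Polynomial ℝ) (hΘdeg : Θ.natDegree = 2) (hΘ : ∀ x : ℤ, θ x = Θ.eval (x : ℝ))
    (ε σ : Fin m → ℤ → ℝ)
    (hεrat : ∀ h, IsRationalSeq (ε h)) (hσrat : ∀ h, IsRationalSeq (σ h))
    (ξ : Fin m → ℤ → ℕ → ℝ)
    (hξ : ∀ h x i, ξ h x i = ∏ j ∈ Finset.range i, ε h (x - (j : ℤ)))
    (Y : Fin m → Polynomial ℝ)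
    (S : ℤ → ℝ) (hSrat : IsRationalSeq S)
    (M : Fin m → ℤ → ℝ)
    (hM : ∀ h (x : ℤ), M h x = ∑ j : Fin m,
      (-1 : ℝ) ^ ((h : ℕ) + (j : ℕ)) * ξ h x (m - (j : ℕ) - 1) * S (x + (j : ℤ) + 1) *
        minorDet m (Matrix.of fun l r : Fin m =>
          ξ l (x + (j : ℤ) - (r : ℤ)) (m - (r : ℕ) - 1) *
            (Y l).eval (θ (x + (j : ℤ) - (r : ℤ)))) h j)
    -- the functions Ψ_j^h and the assumption that they are polynomials
    (Ψ : Fin m → Fin m → ℤ → ℝ)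
    (hΨ : ∀ h j (x : ℤ), Ψ h j x =
      ξ h (x - (j : ℤ) - 1) (m - (j : ℕ) - 1) * S x *
        minorDet m (Matrix.of fun l r : Fin m =>
          ξ l (x - (r : ℤ) - 1) (m - (r : ℕ) - 1) * (Y l).eval (θ (x - (r : ℤ) - 1))) h j)
    (Pψ : Fin m → Fin m → Polynomial ℝ)
    (hPψ : ∀ h j (x : ℤ), Ψ h j x = (Pψ h j).eval (x : ℝ)) :
    -- each S·Ω_g^h is a polynomial in x
    (∀ (h : Fin m) (g : ℕ), ∃ W : Polynomial ℝ, ∀ x : ℤ,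
        S x * OmegaDet m ξ θ (Function.update Y h (Polynomial.X ^ g)) x = W.eval (x : ℝ))
      -- each M_h is a polynomial in x
      ∧ (∀ h : Fin m, ∃ Mp : Polynomial ℝ, ∀ x : ℤ, M h x = Mp.eval (x : ℝ))
      -- the degree bound under the additional degree assumption
      ∧ ∀ W0 : Fin m → Polynomial ℝ,
          (∀ (h : Fin m) (x : ℤ),
            S x * OmegaDet m ξ θ (Function.update Y h (Polynomial.X ^ 0)) x = (W0 h).eval (x : ℝ)) →
          (∀ (h : Fin m) (g : ℕ) (W : Polynomial ℝ),
            g ≤ (Finset.univ.sup fun hj : Fin m × Fin m => (Pψ hj.1 hj.2).natDegree)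
                  - (W0 h).natDegree →
            (∀ x : ℤ,
              S x * OmegaDet m ξ θ (Function.update Y h (Polynomial.X ^ g)) x = W.eval (x : ℝ)) →
            W.natDegree ≤ 2 * g + (W0 h).natDegree) →
          ∀ h : Fin m, ∃ Mp : Polynomial ℝ,
            (∀ x : ℤ, M h x = Mp.eval (x : ℝ)) ∧ Mp.natDegree ≤ (W0 h).natDegree := by
  obtain ⟨n, rfl⟩ : ∃ n, m = n + 1 := ⟨m - 1, by omega⟩
  set F : Fin (n + 1) → Fin (n + 1) → ℝ[X] :=
    fun h j => C ((-1 : ℝ) ^ ((h : ℕ) + (j : ℕ))) * Pψ h j with hFdef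
  set c : Fin (n + 1) → ℝ := fun j => (j : ℝ) + 1 with hc
  have hMpoly : ∀ h (x : ℤ), M h x = (∑ j, taylor (c j) (F h j)).eval (x : ℝ) := by
    intro h x
    rw [hM, eval_finsetSum]
    refine sum_congr rfl fun j _ => ?_
    have hj := hPψ h j (x + (j : ℤ) + 1)
    rw [hΨ] at hj
    have e1 : x + (j : ℤ) + 1 - (j : ℤ) - 1 = x := by ring
    have e2 : ∀ r : ℤ, x + (j : ℤ) + 1 - r - 1 = x + (j : ℤ) - r := fun r => by ring
    rw [e1] at hj
    simp only [e2] at hj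
    rw [taylor_eval, hFdef, eval_mul, eval_C,
      show (x : ℝ) + c j = ((x + (j : ℤ) + 1 : ℤ) : ℝ) by simp [hc]; ring, ← hj]
    ring
  have hWpoly : ∀ h (g : ℕ) (x : ℤ),
      S x * OmegaDet (n + 1) ξ θ (Function.update Y h (X ^ g)) x
        = (∑ j, Θ.comp (X - C (c j)) ^ g * F h j).eval (x : ℝ) := by
    intro h g x
    rw [OmegaDet, Matrix.det_succ_row _ h, mul_sum, eval_finsetSum]
    refine sum_congr rfl fun j _ => ?_
    have hj := hPψ h j x
    rw [hΨ, minorDet] at hj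
    rw [hFdef, eval_mul, eval_mul, eval_C, ← hj, eval_pow, eval_comp, eval_sub, eval_X, eval_C,
      show (x : ℝ) - c j = ((x - (j : ℤ) - 1 : ℤ) : ℝ) by simp [hc]; ring, ← hΘ]
    have hminor : ∀ A B : Matrix (Fin (n + 1)) (Fin (n + 1)) ℝ, (∀ l, l ≠ h → A l = B l) →
        (A.submatrix h.succAbove j.succAbove) = (B.submatrix h.succAbove j.succAbove) := by
      intro A B hAB
      ext i k
      simp [hAB _ (Fin.succAbove_ne h i)]
    rw [hminor _ (Matrix.of fun l r : Fin (n + 1) =>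
          ξ l (x - (r : ℤ) - 1) (n + 1 - (r : ℕ) - 1) * (Y l).eval (θ (x - (r : ℤ) - 1)))
      (fun l hl => by ext r; simp [Function.update_of_ne hl])]
    simp only [Matrix.of_apply, Function.update_self, eval_pow, eval_X]
    ring
  refine ⟨fun h g => ⟨_, hWpoly h g⟩, fun h => ⟨_, hMpoly h⟩, fun W0 _ hdeg h =>
    ⟨_, hMpoly h, ?_⟩⟩
  refine natDegree_sum_taylor_le _ _ _ (natDegree_moment_le Θ hΘdeg _ _ _
    ((univ.sup fun hj : Fin (n + 1) × Fin (n + 1) => (Pψ hj.1 hj.2).natDegree)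
      - (W0 h).natDegree) (fun j => ?_) fun g hg => hdeg h g _ hg (hWpoly h g))
  have h1 : (Pψ h j).natDegree ≤ _ :=
    le_sup (f := fun hj : Fin (n + 1) × Fin (n + 1) => (Pψ hj.1 hj.2).natDegree)
      (mem_univ (h, j))
  have h2 : (F h j).natDegree ≤ (Pψ h j).natDegree := natDegree_C_mul_le _ _
  omega
end

section
/- Let a, b, N be real numbers and let U_1, U_2, U_3, U_4 be finite sets of nonnegative integers with cardinals m_1, m_2, m_3, m_4, elements U_j = {u_i^{j⌉} : i ∈ 𝕌_j}, and m = m_1+m_2+m_3+m_4. Let Y_1,…,Y_m be nonzero polynomials with deg Y_i = u_i^{j⌉} for i ∈ 𝕌_j (j = 1,2,3,4), and let r_i be the leading coefficient of Y_i. Let θ_x = x(x+a+b+1) and σ_x = −(2x+a+b−1). Consider the m×m matrix with columns j = 1,…,m whose rows are: N^{2;m−j}_{x−j} D^{2;j−1}_{x−1} Y_i(θ_{x−j}) for i ∈ 𝕌_1; N^{1;m−j}_{x−j} N^{2;m−j}_{x−j} D^{1;j−1}_{x−1} D^{2;j−1}_{x−1} Y_i(θ_{x−j}) for i ∈ 𝕌_2;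 Y_i(θ_{x−j}) for i ∈ 𝕌_3; and N^{1;m−j}_{x−j} D^{1;j−1}_{x−1} Y_i(θ_{x−j}) for i ∈ 𝕌_4, and define P(x) as its determinant divided by p(x)q(x), where p(x) = ∏_{i=1}^{m_2+m_4−1} N^{1;m_2+m_4−i}_{x−m_1−m_3−i} D^{1;m_2+m_4−i}_{x−1} · ∏_{i=1}^{m_1+m_2−1} N^{2;m_1+m_2−i}_{x−m_3−m_4−i} D^{2;m_1+m_2−i}_{x−1} and q(x) = (−1)^{m(m−1)/2} ∏_{p=1}^{m−1} ∏_{s=1}^{p} σ_{x−m+(s+p+1)/2}. If z−u+b+N+1 ≠ 0 and w−v+a+N+1 ≠ 0 for all u ∈ U_1, v ∈ U_2, w ∈ U_3, z ∈ U_4, then P is a polynomial of degree d = 2·Σ_{u ∈ U_1∪U_2∪U_3∪U_4} u − 2·Σ_{i=1}^4 C(m_i,2), with leading coefficient r = (−1)^{Σ_{i=1}^4 C(m_i,2) + m_1 m_2 + m_2 m_3 + m_3 m_4} · V_{U_1} V_{U_2} V_{U_3} V_{U_4} · ∏_{i=1}^m r_i · ∏_{v∈U_2, w∈U_3}(N+a+1−v+w)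 · ∏_{u∈U_1, z∈U_4}(N+b+1−u+z), where V_X = ∏_{i<j}(x_j − x_i) is the Vandermonde determinant of the set X = {x_1 < x_2 < ⋯}. -/
open Polynomial Finset

/-- Pochhammer symbol `(z)_k = z(z+1)⋯(z+k−1)` for real `z`. -/
noncomputable def pch (k : ℕ) (z : ℝ) : ℝ := (ascPochhammer ℝ k).eval z

/-- `N^{1;j}_x = (x−j+b+1)_j`. -/
noncomputable def NN1 (b : ℝ) (j : ℕ) (x : ℝ) : ℝ := pch j (x - (j : ℝ) + b + 1)

/-- `N^{2;j}_x = (x−j−N)_j`. -/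
noncomputable def NN2 (NP : ℝ) (j : ℕ) (x : ℝ) : ℝ := pch j (x - (j : ℝ) - NP)

/-- `D^{1;j}_x = (−1)^j (x−j+a+1)_j`. -/
noncomputable def DD1 (a : ℝ) (j : ℕ) (x : ℝ) : ℝ := (-1 : ℝ) ^ j * pch j (x - (j : ℝ) + a + 1)

/-- `D^{2;j}_x = (−1)^j (x−j+a+b+N+2)_j`. -/
noncomputable def DD2 (a b NP : ℝ) (j : ℕ) (x : ℝ) : ℝ :=
  (-1 : ℝ) ^ j * pch j (x - (j : ℝ) + a + b + NP + 2)

/-- The denominator polynomial `p(x)` of Lemma 4.1. -/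
noncomputable def pDen (a b NP : ℝ) (m1 m2 m3 m4 : ℕ) (x : ℝ) : ℝ :=
  (∏ i ∈ Finset.Icc 1 (m2 + m4 - 1),
      NN1 b (m2 + m4 - i) (x - (m1 : ℝ) - (m3 : ℝ) - (i : ℝ)) * DD1 a (m2 + m4 - i) (x - 1))
    * ∏ i ∈ Finset.Icc 1 (m1 + m2 - 1),
        NN2 NP (m1 + m2 - i) (x - (m3 : ℝ) - (m4 : ℝ) - (i : ℝ)) *
          DD2 a b NP (m1 + m2 - i) (x - 1)

/-- The denominator `q(x) = (−1)^{m(m−1)/2} ∏_{p=1}^{m−1} ∏_{s=1}^p σ_{x−m+(s+p+1)/2}`,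
with `σ_t = −(2t+a+b−1)`. -/
noncomputable def qDen (a b : ℝ) (m : ℕ) (x : ℝ) : ℝ :=
  (-1 : ℝ) ^ (m * (m - 1) / 2) *
    ∏ p ∈ Finset.Icc 1 (m - 1), ∏ s ∈ Finset.Icc 1 p,
      -(2 * (x - (m : ℝ) + ((s : ℝ) + (p : ℝ) + 1) / 2) + a + b - 1)

/-- The Vandermonde determinant of a finite set of naturals,
`V_X = ∏_{i<j} (x_j − x_i)`. -/
noncomputable def vandermondeSet (U : Finset ℕ) : ℝ :=
  ∏ p ∈ (U ×ˢ U).filter fun p => p.1 < p.2, ((p.2 : ℝ) - (p.1 : ℝ))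

/-- The product of `F i j` over all pairs `i < j < m`. -/
def pairProd {M : Type*} [CommMonoid M] (F : ℕ → ℕ → M) (m : ℕ) : M :=
  ∏ j ∈ range m, ∏ i ∈ range j, F i j

/-- The sum of `F i j` over all pairs `i < j < m`. -/
def pairSum (F : ℕ → ℕ → ℤ) (m : ℕ) : ℤ :=
  ∑ j ∈ range m, ∑ i ∈ range j, F i j

theorem pairProd_add {M : Type*} [CommMonoid M] (F : ℕ → ℕ → M) (m n : ℕ) :
    pairProd F (m + n) = pairProd F m * (∏ i ∈ range m, ∏ j ∈ range n, F i (m + j)) *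
      pairProd (fun i j => F (m + i) (m + j)) n := by
  simp only [pairProd, prod_range_add, prod_mul_distrib]
  rw [prod_comm (s := range n), mul_assoc]

theorem pairSum_add (F : ℕ → ℕ → ℤ) (m n : ℕ) :
    pairSum F (m + n) = pairSum F m + (∑ i ∈ range m, ∑ j ∈ range n, F i (m + j)) +
      pairSum (fun i j => F (m + i) (m + j)) n := by
  simp only [pairSum, sum_range_add, sum_add_distrib]
  rw [sum_comm (s := range n), add_assoc]

theorem pairProd_succ {M : Type*} [CommMonoid M] (F : ℕ → ℕ → M) (n : ℕ) :
    pairProd F (n + 1) =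
      (∏ j ∈ range n, F 0 (j + 1)) * pairProd (fun i j => F (i + 1) (j + 1)) n := by
  rw [add_comm n 1, pairProd_add]
  simp [pairProd, add_comm]

theorem pairSum_succ (F : ℕ → ℕ → ℤ) (n : ℕ) :
    pairSum F (n + 1) =
      (∑ j ∈ range n, F 0 (j + 1)) + pairSum (fun i j => F (i + 1) (j + 1)) n := by
  rw [add_comm n 1, pairSum_add]
  simp [pairSum, add_comm]

theorem pairProd_congr {M : Type*} [CommMonoid M] {F G : ℕ → ℕ → M} {m : ℕ}
    (h : ∀ i j, i < j → j < m → F i j = G i j) : pairProd F m = pairProd G m :=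
  prod_congr rfl fun j hj => prod_congr rfl fun i hi =>
    h i j (mem_range.1 hi) (mem_range.1 hj)

theorem pairSum_congr {F G : ℕ → ℕ → ℤ} {m : ℕ}
    (h : ∀ i j, i < j → j < m → F i j = G i j) : pairSum F m = pairSum G m :=
  sum_congr rfl fun j hj => sum_congr rfl fun i hi =>
    h i j (mem_range.1 hi) (mem_range.1 hj)

theorem pairProd_mul {M : Type*} [CommMonoid M] (F G : ℕ → ℕ → M) (m : ℕ) :
    pairProd (fun i j => F i j * G i j) m = pairProd F m * pairProd G m := by
  simp [pairProd, prod_mul_distrib]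

theorem sum_range_id_eq_choose (m : ℕ) : ∑ j ∈ range m, j = m.choose 2 := by
  rw [sum_range_id, Nat.choose_two_right]

theorem pairProd_const {M : Type*} [CommMonoid M] (c : M) (m : ℕ) :
    pairProd (fun _ _ => c) m = c ^ m.choose 2 := by
  simp only [pairProd, prod_const, card_range]
  rw [prod_pow_eq_pow_sum, sum_range_id_eq_choose]

theorem pairSum_const (c : ℤ) (m : ℕ) : pairSum (fun _ _ => c) m = m.choose 2 * c := by
  simp only [pairSum, sum_const, card_range, nsmul_eq_mul, ← sum_mul]
  rw [← sum_range_id_eq_choose]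
  push_cast
  rfl

/-- `f x` is asymptotically `c * x ^ d` as `x → ∞`, where `c = 0` means `o(x ^ d)`. -/
def LeadsAt (d : ℤ) (c : ℝ) (f : ℝ → ℝ) : Prop :=
  Filter.Tendsto (fun x => f x * x ^ (-d)) Filter.atTop (nhds c)

namespace LeadsAt

variable {d d' : ℤ} {c c' : ℝ} {f g : ℝ → ℝ}

theorem congr' (h : LeadsAt d c f) (hfg : f =ᶠ[Filter.atTop] g) : LeadsAt d c g :=
  Filter.Tendsto.congr' (hfg.mono fun x hx => by simp only [hx]) h

theorem add (hf : LeadsAt d c f) (hg : LeadsAt d c' g) :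
    LeadsAt d (c + c') (fun x => f x + g x) :=
  (Filter.Tendsto.add hf hg).congr fun x => by ring

theorem mul (hf : LeadsAt d c f) (hg : LeadsAt d' c' g) :
    LeadsAt (d + d') (c * c') (fun x => f x * g x) := by
  refine (Filter.Tendsto.mul hf hg).congr' ?_
  filter_upwards [Filter.eventually_gt_atTop (0 : ℝ)] with x hx
  rw [neg_add, zpow_add₀ hx.ne']
  ring

theorem const (c : ℝ) : LeadsAt 0 c (fun _ => c) := by
  simp [LeadsAt]

theorem const_mul (hf : LeadsAt d c f) (k : ℝ) : LeadsAt d (k * c) (fun x => k * f x) := by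
  simpa using (const k).mul hf

theorem inv (hf : LeadsAt d c f) (hc : c ≠ 0) : LeadsAt (-d) c⁻¹ (fun x => (f x)⁻¹) := by
  refine (Filter.Tendsto.inv₀ hf hc).congr fun x => ?_
  simp [mul_comm]

theorem lower (hf : LeadsAt d c f) : LeadsAt (d + 1) 0 f := by
  have h := Filter.Tendsto.mul hf (tendsto_inv_atTop_zero (𝕜 := ℝ))
  rw [mul_zero] at h
  refine h.congr' ?_
  filter_upwards [Filter.eventually_gt_atTop (0 : ℝ)] with x hx
  rw [neg_add, zpow_add₀ hx.ne', zpow_neg_one]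
  ring

theorem eventually_ne (hf : LeadsAt d c f) (hc : c ≠ 0) : ∀ᶠ x in Filter.atTop, f x ≠ 0 :=
  (Filter.Tendsto.eventually_ne hf hc).mono fun x hx h => hx (by simp [h])

theorem linear (k l : ℝ) : LeadsAt 1 k (fun x => k * x + l) := by
  have h := (tendsto_inv_atTop_zero (𝕜 := ℝ)).const_mul l
  have h2 := h.const_add k
  rw [mul_zero, add_zero] at h2
  refine h2.congr' ?_
  filter_upwards [Filter.eventually_gt_atTop (0 : ℝ)] with x hx
  rw [zpow_neg_one]
  field_simp

theorem prod {ι : Type*} (s : Finset ι) {d : ι → ℤ} {c : ι → ℝ} {f : ι → ℝ → ℝ}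
    (h : ∀ i ∈ s, LeadsAt (d i) (c i) (f i)) :
    LeadsAt (∑ i ∈ s, d i) (∏ i ∈ s, c i) (fun x => ∏ i ∈ s, f i x) := by
  classical
  induction s using Finset.induction_on with
  | empty => simpa using const 1
  | insert a s ha ih =>
    simp only [sum_insert ha, prod_insert ha]
    exact (h a (mem_insert_self _ _)).mul (ih fun i hi => h i (mem_insert_of_mem hi))

end LeadsAt

/-- The sequence of functions `f 0, …, f n` behaves like `c * x ^ d * (1 - j / x) ^ p` in the sense
that each iterated difference in `j`, up to order `n`, has the leading term this predicts. -/
def DiffLeads : ℕ → ℤ → ℝ → ℝ → (ℕ → ℝ → ℝ) → Prop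
  | 0, d, _, c, f => LeadsAt d c (f 0)
  | n + 1, d, p, c, f => (∀ j ≤ n + 1, LeadsAt d c (f j)) ∧
      DiffLeads n (d - 1) (p - 1) (-p * c) (fun j x => f (j + 1) x - f j x)

namespace DiffLeads

theorem leadsAt {n : ℕ} {d : ℤ} {p c : ℝ} {f : ℕ → ℝ → ℝ} (h : DiffLeads n d p c f) {j : ℕ}
    (hj : j ≤ n) : LeadsAt d c (f j) := by
  cases n with
  | zero => obtain rfl := Nat.le_zero.1 hj; exact h
  | succ n => exact h.1 j hj

theorem congr' {n : ℕ} {d : ℤ} {p c : ℝ} {f g : ℕ → ℝ → ℝ} (h : DiffLeads n d p c f)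
    (hfg : ∀ j ≤ n, f j =ᶠ[Filter.atTop] g j) : DiffLeads n d p c g := by
  induction n generalizing d p c f g with
  | zero => exact LeadsAt.congr' h (hfg 0 le_rfl)
  | succ n ih =>
    refine ⟨fun j hj => (h.1 j hj).congr' (hfg j hj), ih h.2 fun j hj => ?_⟩
    filter_upwards [hfg j (by omega), hfg (j + 1) (by omega)] with x h1 h2
    rw [h1, h2]

theorem of_succ {n : ℕ} {d : ℤ} {p c : ℝ} {f : ℕ → ℝ → ℝ} (h : DiffLeads (n + 1) d p c f) :
    DiffLeads n d p c f := by
  induction n generalizing d p c f with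
  | zero => exact h.1 0 (by omega)
  | succ n ih => exact ⟨fun j hj => h.1 j (by omega), ih h.2⟩

theorem shift {n : ℕ} {d : ℤ} {p c : ℝ} {f : ℕ → ℝ → ℝ} (h : DiffLeads (n + 1) d p c f) :
    DiffLeads n d p c (fun j => f (j + 1)) := by
  induction n generalizing d p c f with
  | zero => exact h.1 1 le_rfl
  | succ n ih => exact ⟨fun j hj => h.1 (j + 1) (by omega), ih h.2⟩

theorem add {n : ℕ} {d : ℤ} {p c c' : ℝ} {f g : ℕ → ℝ → ℝ} (hf : DiffLeads n d p c f)
    (hg : DiffLeads n d p c' g) : DiffLeads n d p (c + c') (fun j x => f j x + g j x) := by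
  induction n generalizing d p c c' f g with
  | zero => exact LeadsAt.add hf hg
  | succ n ih =>
    refine ⟨fun j hj => (hf.1 j hj).add (hg.1 j hj), ?_⟩
    have h := ih hf.2 hg.2
    rw [← mul_add] at h
    exact h.congr' fun j _ => .of_forall fun x => by ring

theorem const_mul {n : ℕ} {d : ℤ} {p c : ℝ} {f : ℕ → ℝ → ℝ} (hf : DiffLeads n d p c f) (k : ℝ) :
    DiffLeads n d p (k * c) (fun j x => k * f j x) := by
  induction n generalizing d p c f with
  | zero => exact LeadsAt.const_mul hf k
  | succ n ih =>
    refine ⟨fun j hj => (hf.1 j hj).const_mul k, ?_⟩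
    have h := ih hf.2
    rw [mul_left_comm] at h
    exact h.congr' fun j _ => .of_forall fun x => by ring

theorem mul {n : ℕ} {d d' : ℤ} {p p' c c' : ℝ} {f g : ℕ → ℝ → ℝ} (hf : DiffLeads n d p c f)
    (hg : DiffLeads n d' p' c' g) :
    DiffLeads n (d + d') (p + p') (c * c') (fun j x => f j x * g j x) := by
  induction n generalizing d d' p p' c c' f g with
  | zero => exact LeadsAt.mul hf hg
  | succ n ih =>
    refine ⟨fun j hj => (hf.1 j hj).mul (hg.1 j hj), ?_⟩
    have h1 := ih hf.2 hg.of_succ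
    have h2 := ih hf.shift hg.2
    rw [show d - 1 + d' = d + d' - 1 by ring, show p - 1 + p' = p + p' - 1 by ring] at h1
    rw [show d + (d' - 1) = d + d' - 1 by ring, show p + (p' - 1) = p + p' - 1 by ring] at h2
    have h := h1.add h2
    rw [show -p * c * c' + c * (-p' * c') = -(p + p') * (c * c') by ring] at h
    exact h.congr' fun j _ => .of_forall fun x => by ring

theorem zero (n : ℕ) (d : ℤ) (p : ℝ) : DiffLeads n d p 0 (fun _ _ => 0) := by
  induction n generalizing d p with
  | zero => simp [DiffLeads, LeadsAt]
  | succ n ih => exact ⟨fun j _ => by simp [LeadsAt], by simpa using ih (d - 1) (p - 1)⟩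

theorem const (n : ℕ) (c : ℝ) : DiffLeads n 0 0 c (fun _ _ => c) := by
  cases n with
  | zero => exact LeadsAt.const c
  | succ n => exact ⟨fun j _ => LeadsAt.const c, by simpa using zero n (-1) (-1)⟩

theorem inv {n : ℕ} {d : ℤ} {p c : ℝ} {f : ℕ → ℝ → ℝ} (hf : DiffLeads n d p c f) (hc : c ≠ 0) :
    DiffLeads n (-d) (-p) c⁻¹ (fun j x => (f j x)⁻¹) := by
  induction n generalizing d p c f with
  | zero => exact LeadsAt.inv hf hc
  | succ n ih =>
    refine ⟨fun j hj => (hf.1 j hj).inv hc, ?_⟩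
    have h := ((hf.2.mul (ih hf.of_succ hc)).mul (ih hf.shift hc)).const_mul (-1)
    rw [show d - 1 + -d + -d = -d - 1 by ring, show p - 1 + -p + -p = -p - 1 by ring,
      show -1 * (-p * c * c⁻¹ * c⁻¹) = - -p * c⁻¹ by field_simp] at h
    refine h.congr' fun j hj => ?_
    filter_upwards [(hf.1 j (by omega)).eventually_ne hc,
      (hf.1 (j + 1) (by omega)).eventually_ne hc] with x h1 h2
    field_simp
    ring

theorem lower {n : ℕ} {d : ℤ} {p c : ℝ} {f : ℕ → ℝ → ℝ} (hf : DiffLeads n d p c f) (p' : ℝ) :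
    DiffLeads n (d + 1) p' 0 f := by
  induction n generalizing d p p' c f with
  | zero => exact LeadsAt.lower hf
  | succ n ih =>
    refine ⟨fun j hj => (hf.1 j hj).lower, ?_⟩
    have h := ih hf.2 (p' - 1)
    rwa [show d - 1 + 1 = d + 1 - 1 by ring, ← mul_zero (-p')] at h

theorem lower_of_lt {n : ℕ} {d d' : ℤ} {p c : ℝ} {f : ℕ → ℝ → ℝ} (hf : DiffLeads n d p c f)
    (hd : d < d') (p' : ℝ) : DiffLeads n d' p' 0 f := by
  induction d', hd using Int.leInduction with
  | base => exact hf.lower p'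
  | succ k _ ih => exact ih.lower p'

theorem sum {n : ℕ} {d : ℤ} {p : ℝ} {ι : Type*} (s : Finset ι) {c : ι → ℝ}
    {f : ι → ℕ → ℝ → ℝ} (h : ∀ i ∈ s, DiffLeads n d p (c i) (f i)) :
    DiffLeads n d p (∑ i ∈ s, c i) (fun j x => ∑ i ∈ s, f i j x) := by
  classical
  induction s using Finset.induction_on with
  | empty => simpa using zero n d p
  | insert a s ha ih =>
    simp only [sum_insert ha]
    exact (h a (mem_insert_self _ _)).add (ih fun i hi => h i (mem_insert_of_mem hi))

theorem pow {n : ℕ} {d : ℤ} {p : ℝ} {f : ℕ → ℝ → ℝ} (hf : DiffLeads n d p 1 f) (k : ℕ) :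
    DiffLeads n (k * d) (k * p) 1 (fun j x => f j x ^ k) := by
  induction k with
  | zero => simpa using const n 1
  | succ k ih =>
    have h := ih.mul hf
    simp only [pow_succ]
    push_cast
    rwa [add_mul, add_mul, one_mul, one_mul, ← mul_one (1 : ℝ)]

theorem sub_natCast (n : ℕ) (k : ℝ) : DiffLeads n 1 1 1 (fun j x => x + k - j) := by
  have hl : ∀ j : ℕ, LeadsAt 1 1 (fun x => x + k - j) := fun j =>
    (LeadsAt.linear 1 (k - j)).congr' (.of_forall fun x => by ring)
  cases n with
  | zero => exact hl 0
  | succ n =>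
    refine ⟨fun j _ => hl j, ?_⟩
    have h := const n (-1)
    rw [sub_self, sub_self, mul_one]
    exact h.congr' fun j _ => .of_forall fun x => by push_cast; ring

theorem polynomial_eval {n : ℕ} {f : ℕ → ℝ → ℝ} (hf : DiffLeads n 2 2 1 f) (Y : ℝ[X]) :
    DiffLeads n (2 * Y.natDegree) (2 * Y.natDegree) Y.leadingCoeff
      (fun j x => Y.eval (f j x)) := by
  have hk : ∀ k ∈ range (Y.natDegree + 1), DiffLeads n (2 * Y.natDegree) (2 * Y.natDegree)
      (if k = Y.natDegree then Y.leadingCoeff else 0) (fun j x => Y.coeff k * f j x ^ k) := by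
    intro k hk
    have h := (hf.pow k).const_mul (Y.coeff k)
    split_ifs with hY
    · subst hY
      rwa [mul_one, mul_comm _ (2 : ℤ), mul_comm _ (2 : ℝ)] at h
    · have := mem_range.1 hk
      exact h.lower_of_lt (by omega) _
  have h := sum _ hk
  rw [sum_ite_eq' (range _)] at h
  simpa [eval_eq_sum_range] using h

end DiffLeads

theorem det_twisted_succ {m : ℕ} (l : ℕ → ℝ) (f : ℕ → ℕ → ℝ) (hl : l 0 * l 0 = 1)
    (hf : ∀ j ≤ m, f 0 j ≠ 0) :
    Matrix.det (Matrix.of fun i j : Fin (m + 1) => l i ^ (j : ℕ) * f i j) =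
      (∏ j ∈ range (m + 1), l 0 ^ j * f 0 j) *
        Matrix.det (Matrix.of fun i j : Fin m => (l (i + 1) * l 0) ^ (j : ℕ) *
          (l (i + 1) * l 0 * (f (i + 1) (j + 1) * (f 0 (j + 1))⁻¹) -
            f (i + 1) j * (f 0 j)⁻¹)) := by
  have hlj : ∀ j : ℕ, l 0 ^ j * l 0 ^ j = 1 := fun j => by rw [← mul_pow, hl, one_pow]
  set A : Matrix (Fin (m + 1)) (Fin (m + 1)) ℝ :=
    Matrix.of fun i j => (l i * l 0) ^ (j : ℕ) * (f i j * (f 0 j)⁻¹) with hA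
  set B : Matrix (Fin (m + 1)) (Fin (m + 1)) ℝ :=
    Matrix.of fun i j => if (j : ℕ) = 0 then A i 0 else A i j - A i (j - 1) with hB
  have hM : (Matrix.of fun i j : Fin (m + 1) => l i ^ (j : ℕ) * f i j) =
      Matrix.of fun i j : Fin (m + 1) => (l 0 ^ (j : ℕ) * f 0 j) * A i j := by
    ext i j
    have := hf j (by omega)
    simp only [hA, Matrix.of_apply, mul_pow]
    field_simp
    rw [pow_right_comm, sq, hl, one_pow, mul_one]
  have hAB : A.det = B.det := by
    refine Matrix.det_eq_of_forall_col_eq_smul_add_pred (fun _ => 1) (fun i => by simp [hB]) ?_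
    intro i j
    have : (j.succ - 1 : Fin (m + 1)) = j.castSucc := by
      rw [← Fin.coeSucc_eq_succ, add_sub_cancel_right]
    simp [hB, this]
  have hA0 : ∀ j, A 0 j = 1 := by
    intro j
    have := hf j (by omega)
    simp [hA, hl, this]
  have hB0 : ∀ j : Fin m, B 0 j.succ = 0 := by
    intro j
    simp [hB, hA0]
  rw [hM, Matrix.det_mul_row, hAB, Matrix.det_succ_row_zero, Fin.sum_univ_succ,
    Fin.prod_univ_eq_prod_range (fun j => l 0 ^ j * f 0 j)]
  simp only [hB0, mul_zero, zero_mul, sum_const_zero, add_zero]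
  have hB00 : B 0 0 = 1 := by simp [hB, hA0]
  rw [hB00]
  simp only [Fin.val_zero, pow_zero, one_mul]
  congr 2
  ext i j
  have : (j.succ - 1 : Fin (m + 1)) = j.castSucc := by
    rw [← Fin.coeSucc_eq_succ, add_sub_cancel_right]
  simp only [hB, hA, Matrix.submatrix_apply, Matrix.of_apply, Fin.succAbove_zero, Fin.val_succ,
    this, Fin.val_castSucc, Nat.succ_ne_zero, if_false]
  ring

/-- Leading behaviour of a determinant whose `i`-th row is `(±1) ^ j * f i j`, with `f i j`
behaving like `c i * x ^ d i * (1 - j / x) ^ p i`. -/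
theorem leadsAt_det (m : ℕ) (l p c : ℕ → ℝ) (d : ℕ → ℤ) (f : ℕ → ℕ → ℝ → ℝ)
    (hl : ∀ i < m, l i = 1 ∨ l i = -1) (hc : ∀ i < m, c i ≠ 0)
    (hp : ∀ i j, i < j → j < m → l i = l j → p i ≠ p j)
    (hf : ∀ i < m, DiffLeads (m - 1) (d i) (p i) (c i) (f i)) :
    LeadsAt (∑ i ∈ range m, d i - pairSum (fun i j => if l i = l j then 1 else 0) m)
      ((∏ i ∈ range m, c i) * pairProd (fun i j => l i * if l i = l j then p i - p j else -2) m)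
      (fun x => Matrix.det (Matrix.of fun i j : Fin m => l i ^ (j : ℕ) * f i j x)) := by
  induction m generalizing l p c d f with
  | zero => simpa [pairSum, pairProd] using LeadsAt.const 1
  | succ m ih =>
    have hl0 := hl 0 (by omega)
    have hl0' : l 0 * l 0 = 1 := by rcases hl0 with h | h <;> simp [h]
    have hc0 := hc 0 (by omega)
    have hf0 := hf 0 (by omega)
    rw [Nat.add_sub_cancel] at hf
    have hprod : LeadsAt ((m + 1) * d 0) (∏ j ∈ range (m + 1), l 0 ^ j * c 0)
        (fun x => ∏ j ∈ range (m + 1), l 0 ^ j * f 0 j x) := by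
      have h := LeadsAt.prod (range (m + 1)) (d := fun _ => d 0) (c := fun j => l 0 ^ j * c 0)
        (f := fun j x => l 0 ^ j * f 0 j x)
        fun j hj => (hf0.leadsAt (Nat.lt_succ_iff.1 (mem_range.1 hj))).const_mul _
      simpa using h
    have hmul : ∀ i < m, l (i + 1) * l 0 = 1 ∨ l (i + 1) * l 0 = -1 := by
      intro i hi
      rcases hl0 with h | h <;> rcases hl (i + 1) (by omega) with h' | h' <;> simp [h, h']
    have heq : ∀ i < m, (l (i + 1) * l 0 = 1 ↔ l 0 = l (i + 1)) := by
      intro i hi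
      rcases hl0 with h | h <;> rcases hl (i + 1) (by omega) with h' | h' <;>
        norm_num [h, h']
    have heq2 : ∀ i j, (l (i + 1) * l 0 = l (j + 1) * l 0 ↔ l (i + 1) = l (j + 1)) := by
      intro i j
      refine mul_left_inj' ?_
      rintro h
      simp [h] at hl0'
    have key := ih (fun i => l (i + 1) * l 0)
      (fun i => if l 0 = l (i + 1) then p (i + 1) - p 0 - 1 else p (i + 1) - p 0)
      (fun i => (if l 0 = l (i + 1) then p 0 - p (i + 1) else -2) * (c (i + 1) * (c 0)⁻¹))
      (fun i => if l 0 = l (i + 1) then d (i + 1) - d 0 - 1 else d (i + 1) - d 0)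
      (fun i j x => l (i + 1) * l 0 * (f (i + 1) (j + 1) x * (f 0 (j + 1) x)⁻¹) -
            f (i + 1) j x * (f 0 j x)⁻¹) hmul ?_ ?_ ?_
    · have h := (hprod.mul key).congr' (g := fun x => Matrix.det
        (Matrix.of fun i j : Fin (m + 1) => l i ^ (j : ℕ) * f i j x)) ?_
      · simp only [heq2] at h
        convert h using 1
        · rw [sum_range_succ', pairSum_succ]
          have : ∀ i, (if l 0 = l (i + 1) then d (i + 1) - d 0 - 1 else d (i + 1) - d 0) =
              d (i + 1) - d 0 - if l 0 = l (i + 1) then 1 else 0 := by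
            intro i; split_ifs <;> ring
          simp only [this, sum_sub_distrib, sum_const, card_range, nsmul_eq_mul]
          ring
        · rw [prod_range_succ', pairProd_succ]
          simp only [prod_mul_distrib, prod_const, card_range]
          have hpp : pairProd (fun i j => l (i + 1) * l 0 *
              if l (i + 1) = l (j + 1) then
                (if l 0 = l (i + 1) then p (i + 1) - p 0 - 1 else p (i + 1) - p 0) -
                  (if l 0 = l (j + 1) then p (j + 1) - p 0 - 1 else p (j + 1) - p 0)
              else -2) m =
              l 0 ^ m.choose 2 * pairProd (fun i j => l (i + 1) *
                if l (i + 1) = l (j + 1) then p (i + 1) - p (j + 1) else -2) m := by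
            rw [← pairProd_const, ← pairProd_mul]
            refine pairProd_congr fun i j _ _ => ?_
            split_ifs with h1 h2 h3 h3
            · ring
            · exact absurd (h2.trans h1) h3
            · exact absurd (h3.trans h1.symm) h2
            · ring
            · ring
          rw [hpp, prod_pow_eq_pow_sum, sum_range_id_eq_choose]
          have hch : l 0 ^ (m + 1).choose 2 * l 0 ^ m.choose 2 = l 0 ^ m := by
            rw [Nat.choose_succ_succ' m 1, Nat.choose_one_right, pow_add, mul_assoc, ← mul_pow,
              hl0', one_pow, mul_one]
          rw [← hch]
          have : c 0 ^ (m + 1) * (c 0 ^ m)⁻¹ = c 0 := by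
            rw [pow_succ]; field_simp
          linear_combination (- l 0 ^ (m + 1).choose 2 * l 0 ^ m.choose 2 *
            (∏ i ∈ range m, c (i + 1)) *
            (∏ i ∈ range m, if l 0 = l (i + 1) then p 0 - p (i + 1) else -2) *
            pairProd (fun i j => l (i + 1) *
                if l (i + 1) = l (j + 1) then p (i + 1) - p (j + 1) else -2) m) * this
      · have hne : ∀ᶠ x in Filter.atTop, ∀ j ∈ range (m + 1), f 0 j x ≠ 0 :=
          (Filter.eventually_all_finset _).2 fun j hj =>
            (hf0.leadsAt (Nat.lt_succ_iff.1 (mem_range.1 hj))).eventually_ne hc0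
        filter_upwards [hne] with x hx
        rw [det_twisted_succ l (fun i j => f i j x) hl0'
          fun j hj => hx j (mem_range.2 (Nat.lt_succ_of_le hj))]
    · intro i hi
      refine mul_ne_zero ?_ (mul_ne_zero (hc _ (by omega)) (inv_ne_zero hc0))
      split_ifs with h
      · exact sub_ne_zero.2 (hp 0 (i + 1) (by omega) (by omega) h)
      · norm_num
    · intro i j hij hj h
      rw [heq2] at h
      have hpij := hp (i + 1) (j + 1) (by omega) (by omega) h
      intro h'
      apply hpij
      rw [h] at h'
      split_ifs at h' <;> linarith
    · intro i hi
      obtain ⟨k, rfl⟩ : ∃ k, m = k + 1 := ⟨m - 1, by omega⟩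
      rw [Nat.add_sub_cancel]
      have hg := (hf (i + 1) (by omega)).mul (hf0.inv hc0)
      rw [← sub_eq_add_neg, ← sub_eq_add_neg] at hg
      split_ifs with h
      · have h1 := (heq i hi).2 h
        have h2 := hg.2
        rw [neg_sub] at h2
        simpa only [h1, one_mul] using h2
      · have h1 := (hmul i hi).resolve_left (mt (heq i hi).1 h)
        have h2 := (hg.shift.const_mul (-1)).add (hg.of_succ.const_mul (-1))
        rw [show ∀ z : ℝ, -1 * z + -1 * z = -2 * z by intro z; ring] at h2
        simp only [h1]
        exact h2.congr' fun j _ => .of_forall fun x => by ring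

/-- The weight of column `j` built from the shifts `s - i` with `i ≠ j`. -/
def colWeight {A : Type*} [CommRing A] (m : ℕ) (g s : A) (j : ℕ) : A :=
  (∏ i ∈ Ico (j + 1) m, (g + s - i)) * ∏ i ∈ range j, (g - s + i)

/-- The common factor of the products of `n` distinct column weights. -/
def weightDenom {A : Type*} [CommRing A] (m n : ℕ) (g s : A) : A :=
  ∏ k ∈ range n, ((∏ i ∈ Ico (m - k) m, (g + s - i)) * ∏ i ∈ range k, (g - s + i))

/-- Entries of the quasi-Casorati matrix in the centred variable `s`: the rows in `E` carry the
column weight with parameter `g`, those in `E'` the column weight with parameter `g'`. -/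
noncomputable def quasiMatrix {A : Type*} [CommRing A] [Algebra ℝ A] (m : ℕ) (E E' : Finset ℕ)
    (Y : ℕ → ℝ[X]) (g g' s : A) : Matrix (Fin m) (Fin m) A :=
  Matrix.of fun i j => (if (i : ℕ) ∈ E then colWeight m g s j else 1) *
    (if (i : ℕ) ∈ E' then colWeight m g' s j else 1) * aeval ((s - (j : ℕ)) ^ 2) (Y i)

/-- The product of the sums `(s - i) + (s - j)` over `i < j < m`. -/
def shiftSumProd {A : Type*} [CommRing A] (m : ℕ) (s : A) : A :=
  pairProd (fun i j => 2 * s - ((i + j : ℕ) : A)) m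

section Map

variable {A B : Type*} [CommRing A] [CommRing B] [Algebra ℝ A] [Algebra ℝ B] (φ : A →ₐ[ℝ] B)

theorem map_colWeight (m : ℕ) (g s : A) (j : ℕ) :
    φ (colWeight m g s j) = colWeight m (φ g) (φ s) j := by
  simp [colWeight]

theorem map_weightDenom (m n : ℕ) (g s : A) :
    φ (weightDenom m n g s) = weightDenom m n (φ g) (φ s) := by
  simp [weightDenom]

theorem map_shiftSumProd (m : ℕ) (s : A) : φ (shiftSumProd m s) = shiftSumProd m (φ s) := by
  simp [shiftSumProd, pairProd, two_mul]

theorem map_quasiMatrix_apply (m : ℕ) (E E' : Finset ℕ) (Y : ℕ → ℝ[X]) (g g' s : A)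
    (i j : Fin m) : φ (quasiMatrix m E E' Y g g' s i j) =
      quasiMatrix m E E' Y (φ g) (φ g') (φ s) i j := by
  simp only [quasiMatrix, Matrix.of_apply, map_mul, apply_ite φ, map_colWeight, map_one,
    ← aeval_algHom_apply, map_pow, map_sub, map_natCast]

theorem map_det_quasiMatrix (m : ℕ) (E E' : Finset ℕ) (Y : ℕ → ℝ[X]) (g g' s : A) :
    φ (quasiMatrix m E E' Y g g' s).det = (quasiMatrix m E E' Y (φ g) (φ g') (φ s)).det := by
  rw [AlgHom.map_det]
  congr 1
  ext i j
  exact map_quasiMatrix_apply φ m E E' Y g g' s i j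

end Map

theorem weightDenom_dvd_prod {A : Type*} [CommRing A] (m : ℕ) (g s : A) {S : Finset ℕ}
    (hS : S ⊆ range m) : weightDenom m #S g s ∣ ∏ j ∈ S, colWeight m g s j := by
  simp only [weightDenom, colWeight, prod_mul_distrib]
  have hcard : ∀ i, #S ≤ #{j ∈ S | j < i} + (m - i) := by
    intro i
    rw [← card_filter_add_card_filter_not (s := S) (fun j => j < i), ← Nat.card_Ico i m]
    gcongr
    intro j hj
    rw [mem_filter] at hj
    have := mem_range.1 (hS hj.1)
    exact mem_Ico.2 ⟨not_lt.1 hj.2, this⟩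
  have hcard' : ∀ i < m, #S ≤ #{j ∈ S | i < j} + (i + 1) := by
    intro i hi
    rw [← card_filter_add_card_filter_not (s := S) (fun j => i < j)]
    gcongr
    refine (card_le_card (t := range (i + 1)) ?_).trans_eq (card_range _)
    intro j hj
    rw [mem_filter] at hj
    exact mem_range.2 (by omega)
  refine mul_dvd_mul ?_ ?_
  · rw [prod_comm' (t' := range m) (s' := fun i => Ico (m - i) #S),
      prod_comm' (s := S) (t' := range m) (s' := fun i => {j ∈ S | j < i})]
    · refine prod_dvd_prod_of_dvd _ _ fun i hi => ?_
      rw [prod_const, prod_const, Nat.card_Ico]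
      refine pow_dvd_pow _ ?_
      have := hcard i
      omega
    · intro j i
      simp only [mem_Ico, mem_filter, mem_range]
      constructor
      · rintro ⟨h1, h2, h3⟩
        exact ⟨⟨h1, by omega⟩, h3⟩
      · rintro ⟨⟨h1, h2⟩, h3⟩
        exact ⟨h1, by omega, h3⟩
    · intro k i
      simp only [mem_Ico, mem_range]
      omega
  · rw [prod_comm' (t' := range m) (s' := fun i => Ico (i + 1) #S),
      prod_comm' (s := S) (t' := range m) (s' := fun i => {j ∈ S | i < j})]
    · refine prod_dvd_prod_of_dvd _ _ fun i hi => ?_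
      rw [prod_const, prod_const, Nat.card_Ico]
      refine pow_dvd_pow _ ?_
      have := hcard' i (mem_range.1 hi)
      omega
    · intro j i
      simp only [mem_filter, mem_range]
      constructor
      · rintro ⟨h1, h2⟩
        have := mem_range.1 (hS h1)
        exact ⟨⟨h1, by omega⟩, by omega⟩
      · rintro ⟨⟨h1, h2⟩, h3⟩
        exact ⟨h1, by omega⟩
    · intro k i
      have : #S ≤ m := (card_le_card hS).trans_eq (card_range m)
      simp only [mem_Ico, mem_range]
      omega

theorem weightDenom_dvd_prod_perm {A : Type*} [CommRing A] (m : ℕ) (g s : A) {E : Finset ℕ}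
    (hE : E ⊆ range m) (σ : Equiv.Perm (Fin m)) :
    weightDenom m #E g s ∣
      ∏ j : Fin m, if (σ j : ℕ) ∈ E then colWeight m g s j else 1 := by
  set S : Finset ℕ := ({j : Fin m | (σ j : ℕ) ∈ E} : Finset (Fin m)).map Fin.valEmbedding
  have hcard : #S = #E := by
    rw [card_map]
    refine card_bij (fun j _ => (σ j : ℕ)) (fun j hj => (mem_filter.1 hj).2) ?_ ?_
    · intro i _ j _ h
      exact σ.injective (Fin.ext h)
    · intro i hi
      refine ⟨σ.symm ⟨i, mem_range.1 (hE hi)⟩, ?_, ?_⟩ <;> simp [hi]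
  have hS : S ⊆ range m := by
    intro j hj
    obtain ⟨i, _, rfl⟩ := mem_map.1 hj
    exact mem_range.2 i.2
  have h := weightDenom_dvd_prod m g s hS
  rw [hcard, prod_map, prod_filter] at h
  exact h

theorem weightDenom_dvd_det {A : Type*} [CommRing A] [Algebra ℝ A] (m : ℕ) {E E' : Finset ℕ}
    (hE : E ⊆ range m) (hE' : E' ⊆ range m) (Y : ℕ → ℝ[X]) (g g' s : A) :
    weightDenom m #E g s * weightDenom m #E' g' s ∣ (quasiMatrix m E E' Y g g' s).det := by
  rw [Matrix.det_apply']
  refine dvd_sum fun σ _ => dvd_mul_of_dvd_right ?_ _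
  simp only [quasiMatrix, Matrix.of_apply, prod_mul_distrib]
  exact dvd_mul_of_dvd_left (mul_dvd_mul (weightDenom_dvd_prod_perm m g s hE σ)
    (weightDenom_dvd_prod_perm m g' s hE' σ)) _

theorem pow_card_dvd_det_of_dvd_sub {A : Type*} [CommRing A] {m : ℕ}
    (M : Matrix (Fin m) (Fin m) A) (π : A) (S : Finset (Fin m)) (ρ : Fin m → Fin m)
    (hρ : ∀ j ∈ S, j < ρ j) (h : ∀ j ∈ S, ∀ i, π ∣ M i j - M i (ρ j)) : π ^ #S ∣ M.det := by
  classical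
  set U : Matrix (Fin m) (Fin m) A := Matrix.of fun k j =>
    (if k = j then 1 else 0) - if k = ρ j then (if j ∈ S then 1 else 0) else 0 with hU
  have hdet : U.det = 1 := by
    rw [Matrix.det_of_isLowerTriangular U]
    · refine prod_eq_one fun j _ => ?_
      simp only [hU, Matrix.of_apply, if_true]
      split_ifs with h1 h2
      · exact absurd h1 (hρ j h2).ne
      · simp
      · simp
    · intro k j hkj
      simp only [OrderDual.toDual_lt_toDual] at hkj
      simp only [hU, Matrix.of_apply, if_neg hkj.ne]
      split_ifs with h1 h2
      · exact absurd (h1 ▸ hρ j h2) hkj.not_gt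
      · simp
      · simp
  choose! v hv using h
  have hMU : M * U = Matrix.of fun i j => (if j ∈ S then π else 1) *
      (Matrix.of fun i j => if j ∈ S then v j i else M i j) i j := by
    ext i j
    simp only [Matrix.mul_apply, hU, Matrix.of_apply, mul_sub, sum_sub_distrib, mul_ite, mul_one,
      mul_zero, sum_ite_eq', mem_univ, if_true]
    split_ifs with hj
    · exact hv j hj i
    · simp
  have := congrArg Matrix.det hMU
  rw [Matrix.det_mul, hdet, mul_one, Matrix.det_mul_row, prod_ite_mem, univ_inter, prod_const]
    at this
  exact ⟨_, this⟩

theorem colWeight_reflect {A : Type*} [CommRing A] {m i j : ℕ} (g s : A) (hij : i ≤ j)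
    (hj : j < m) (hs : 2 * s = ((i + j : ℕ) : A)) : colWeight m g s i = colWeight m g s j := by
  have h : ∏ k ∈ Ico i j, (g - s + k) = ∏ k ∈ Ico (i + 1) (j + 1), (g + s - k) := by
    have h := prod_Ico_reflect (fun k : ℕ => g + s - k) i (n := i + j) (m := j) (by omega)
    rw [show i + j + 1 - j = i + 1 by omega, show i + j + 1 - i = j + 1 by omega] at h
    rw [← h]
    refine prod_congr rfl fun k hk => ?_
    rw [Nat.cast_sub (by have := mem_Ico.1 hk; omega), ← hs]
    ring
  rw [colWeight, colWeight, ← prod_Ico_consecutive _ (show i + 1 ≤ j + 1 by omega) hj,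
    ← prod_range_mul_prod_Ico (fun k : ℕ => g - s + k) hij, h]
  ring

theorem X_sub_C_dvd_column_sub {R : Type*} [CommRing R] [Algebra ℝ R] {m : ℕ}
    (E E' : Finset ℕ) (Y : ℕ → ℝ[X]) (g g' : R) {c : ℕ} (r j j' : Fin m)
    (hj : j < j') (hc : (j + j' : ℕ) = c) :
    X - C (algebraMap ℝ R (c / 2)) ∣ quasiMatrix m E E' Y (C g) (C g') (X : R[X]) r j -
      quasiMatrix m E E' Y (C g) (C g') (X : R[X]) r j' := by
  set s : R := algebraMap ℝ R (c / 2)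
  have hs : 2 * s = ((j + j' : ℕ) : R) := by
    have : (2 : R) = algebraMap ℝ R 2 := (map_ofNat _ 2).symm
    rw [this, ← map_mul, mul_div_cancel₀ _ two_ne_zero, map_natCast, hc]
  set φ : R[X] →ₐ[ℝ] R := (Polynomial.aeval s : R[X] →ₐ[R] R).restrictScalars ℝ with hφ
  have hφC : ∀ a : R, φ (C a) = a := fun a => by simp [hφ]
  have hφX : φ X = s := by simp [hφ]
  have key : ∀ f : R[X], φ f = f.eval s := fun f => by simp [hφ, Polynomial.aeval_def]
  rw [dvd_iff_isRoot, IsRoot.def, ← key, map_sub, map_quasiMatrix_apply, map_quasiMatrix_apply,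
    hφC, hφC, hφX]
  have hsq : (s - ((j : ℕ) : R)) ^ 2 = (s - ((j' : ℕ) : R)) ^ 2 := by
    have : s - ((j : ℕ) : R) = -(s - ((j' : ℕ) : R)) := by
      push_cast at hs
      linear_combination hs
    rw [this, neg_sq]
  simp only [quasiMatrix, Matrix.of_apply, hsq, colWeight_reflect _ s hj.le j'.2 hs, sub_self]

theorem shiftSumProd_eq_prod_fiber {A : Type*} [CommRing A] (m : ℕ) (s : A) :
    shiftSumProd m s = ∏ c ∈ range (2 * m),
      (2 * s - (c : A)) ^ #{q ∈ (range m).sigma fun j => range j | q.2 + q.1 = c} := by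
  rw [shiftSumProd, pairProd, prod_sigma',
    ← prod_fiberwise_of_maps_to (t := range (2 * m)) (g := fun q => q.2 + q.1)]
  · refine prod_congr rfl fun c _ => ?_
    rw [← prod_const]
    exact prod_congr rfl fun q hq => by rw [(mem_filter.1 hq).2]
  · intro q hq
    simp only [mem_sigma, mem_range] at hq ⊢
    omega

theorem shiftSumProd_mul_weightDenom_dvd_det {R : Type*} [CommRing R] [IsDomain R] [Algebra ℝ R]
    {m : ℕ} {E E' : Finset ℕ} (hE : E ⊆ range m) (hE' : E' ⊆ range m) (Y : ℕ → ℝ[X]) (g g' : R)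
    (hg : ∀ r : ℝ, g ≠ algebraMap ℝ R r) (hg' : ∀ r : ℝ, g' ≠ algebraMap ℝ R r) :
    weightDenom m #E (C g) X * weightDenom m #E' (C g') X * shiftSumProd m X ∣
      (quasiMatrix m E E' Y (C g) (C g') (X : R[X])).det := by
  obtain ⟨Q, hQ⟩ := weightDenom_dvd_det m hE hE' Y (C g) (C g') (X : R[X])
  rw [hQ]
  refine mul_dvd_mul_left _ ?_
  have h2 : IsUnit (2 : R) := by
    have : (2 : R) = algebraMap ℝ R 2 := (map_ofNat _ 2).symm
    rw [this]
    exact (IsUnit.mk0 (2 : ℝ) two_ne_zero).map _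
  have hlin : ∀ c : ℕ, 2 * X - (c : R[X]) = C 2 * (X - C (algebraMap ℝ R (c / 2))) := by
    intro c
    have : (2 : R) * algebraMap ℝ R (c / 2) = (c : R) := by
      have : (2 : R) = algebraMap ℝ R 2 := (map_ofNat _ 2).symm
      rw [this, ← map_mul, mul_div_cancel₀ _ two_ne_zero, map_natCast]
    rw [mul_sub, ← C_mul, this, C_ofNat, map_natCast]
  have hndvd : ∀ (n : ℕ) (g : R) (r : ℝ), (∀ r : ℝ, g ≠ algebraMap ℝ R r) →
      ¬ (X - C (algebraMap ℝ R r)) ∣ weightDenom m n (C g) X := by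
    intro n g r hg h
    rw [dvd_iff_isRoot, IsRoot.def] at h
    simp only [weightDenom, eval_prod, eval_mul, eval_sub, eval_add, eval_C, eval_X,
      eval_natCast] at h
    revert h
    refine prod_ne_zero_iff.2 fun k _ => mul_ne_zero ?_ ?_ <;>
      refine prod_ne_zero_iff.2 fun i _ h => ?_
    · apply hg (i - r)
      rw [map_sub, map_natCast]
      linear_combination h
    · apply hg (r - i)
      rw [map_sub, map_natCast]
      linear_combination h
  rw [shiftSumProd_eq_prod_fiber]
  refine prod_dvd_of_coprime ?_ ?_
  · intro c _ c' _ hcc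
    simp only [Function.onFun, hlin]
    refine IsCoprime.pow ?_
    rw [isCoprime_mul_unit_left (h2.map C)]
    refine isCoprime_X_sub_C_of_isUnit_sub ?_
    rw [← map_sub]
    refine (IsUnit.mk0 _ ?_).map _
    rw [← sub_div]
    exact div_ne_zero (sub_ne_zero.2 (Nat.cast_injective.ne hcc)) two_ne_zero
  · intro c _
    rw [hlin, mul_pow, ((h2.map C).pow _).mul_left_dvd]
    have hprime := prime_X_sub_C (algebraMap ℝ R (c / 2))
    refine hprime.pow_dvd_of_dvd_mul_left _
      (a := weightDenom m #E (C g) X * weightDenom m #E' (C g') X) ?_ ?_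
    · exact fun h => (hprime.dvd_or_dvd h).elim (hndvd _ _ _ hg) (hndvd _ _ _ hg')
    · rw [← hQ]
      set ρ : Fin m → Fin m := fun j => if h : c - (j : ℕ) < m then ⟨c - j, h⟩ else j with hρ
      set S : Finset (Fin m) := {j : Fin m | 2 * (j : ℕ) < c ∧ c - (j : ℕ) < m} with hS
      have hSρ : ∀ j ∈ S, j < ρ j ∧ (j + ρ j : ℕ) = c := by
        intro j hj
        obtain ⟨h1, h3⟩ := (mem_filter.1 hj).2
        simp only [hρ, dif_pos h3, Fin.lt_def]
        omega
      refine (pow_dvd_pow _ ?_).trans (pow_card_dvd_det_of_dvd_sub _ _ S ρ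
        (fun j hj => (hSρ j hj).1)
        fun j hj i => X_sub_C_dvd_column_sub E E' Y g g' i _ _ (hSρ j hj).1 (hSρ j hj).2)
      refine card_le_card_of_surjOn (fun j : Fin m => (⟨c - j, j⟩ : Σ _ : ℕ, ℕ)) ?_
      rintro ⟨j, i⟩ hq
      simp only [coe_filter, mem_sigma, mem_range, Set.mem_ofPred_eq] at hq
      refine ⟨⟨i, by omega⟩, ?_, ?_⟩
      · simp only [hS, coe_filter, mem_univ, true_and, Set.mem_ofPred_eq]
        omega
      · simp only [Sigma.mk.injEq, heq_eq_eq, and_true]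
        omega

theorem exists_polynomial_det_eq {m : ℕ} {E E' : Finset ℕ} (hE : E ⊆ range m)
    (hE' : E' ⊆ range m) (Y : ℕ → ℝ[X]) (g g' : ℝ) :
    ∃ Q : ℝ[X], ∀ s : ℝ, (quasiMatrix m E E' Y g g' s).det =
      Q.eval s * (weightDenom m #E g s * weightDenom m #E' g' s * shiftSumProd m s) := by
  have hne : ∀ g r : ℝ, (X + C g : ℝ[X]) ≠ algebraMap ℝ ℝ[X] r := by
    intro g r h
    have := congrArg natDegree h
    rw [natDegree_X_add_C, algebraMap_eq, natDegree_C] at this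
    exact one_ne_zero this
  obtain ⟨Q, hQ⟩ := shiftSumProd_mul_weightDenom_dvd_det hE hE' Y (X + C g) (X + C g')
    (hne g) (hne g')
  refine ⟨Q.map (evalRingHom 0), fun s => ?_⟩
  set φ : ℝ[X][X] →ₐ[ℝ] ℝ :=
    (Polynomial.aeval s).comp (mapAlgHom (Polynomial.aeval (0 : ℝ))) with hφ
  have h := congrArg φ hQ
  have h1 : ∀ g : ℝ, φ (C (X + C g)) = g := fun g => by simp [hφ]
  have h2 : φ X = s := by simp [hφ]
  have h3 : φ Q = (Q.map (evalRingHom 0)).eval s := by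
    simp only [hφ, AlgHom.comp_apply, coe_mapAlgHom, Polynomial.coe_aeval_eq_eval]
    rfl
  rw [map_det_quasiMatrix, map_mul, map_mul, map_mul, map_weightDenom, map_weightDenom,
    map_shiftSumProd, h1, h1, h2, h3] at h
  rw [h, mul_comm]

theorem choose_two_add (m n : ℕ) : (m + n).choose 2 = m.choose 2 + n.choose 2 + m * n := by
  have h : ((m + n).choose 2 : ℚ) = m.choose 2 + n.choose 2 + m * n := by
    simp only [Nat.cast_choose_two]
    push_cast
    ring
  exact_mod_cast h

theorem LeadsAt.eval (Q : ℝ[X]) : LeadsAt Q.natDegree Q.leadingCoeff (fun x => Q.eval x) := by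
  rcases eq_or_ne Q 0 with rfl | hQ
  · simp [LeadsAt]
  have h := div_tendsto_atTop_leadingCoeff_div_of_degree_eq Q (X ^ Q.natDegree)
    (by rw [degree_X_pow, degree_eq_natDegree hQ])
  simpa [LeadsAt, div_eq_mul_inv] using h

theorem LeadsAt.lower_of_lt {d d' : ℤ} {c : ℝ} {f : ℝ → ℝ} (hf : LeadsAt d c f) (hd : d < d') :
    LeadsAt d' 0 f :=
  DiffLeads.lower_of_lt (n := 0) (p := 0) (f := fun _ => f) hf hd 0

theorem LeadsAt.natDegree_eq_and_leadingCoeff_eq {Q : ℝ[X]} {d : ℤ} {c : ℝ}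
    (h : LeadsAt d c (fun x => Q.eval x)) (hc : c ≠ 0) :
    (Q.natDegree : ℤ) = d ∧ Q.leadingCoeff = c := by
  rcases lt_trichotomy (Q.natDegree : ℤ) d with hd | rfl | hd
  · exact absurd (tendsto_nhds_unique h ((LeadsAt.eval Q).lower_of_lt hd)) hc
  · exact ⟨rfl, tendsto_nhds_unique (LeadsAt.eval Q) h⟩
  · have h0 := tendsto_nhds_unique (LeadsAt.eval Q) (h.lower_of_lt hd)
    obtain rfl := leadingCoeff_eq_zero.1 h0
    have : LeadsAt d 0 (fun x => (0 : ℝ[X]).eval x) := by simp [LeadsAt]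
    exact absurd (tendsto_nhds_unique h this) hc

theorem leadsAt_weightDenom {m n : ℕ} (hn : n ≤ m) (g k : ℝ) :
    LeadsAt (2 * n.choose 2) ((-1) ^ n.choose 2) (fun x => weightDenom m n g (x + k)) := by
  have h : ∀ r ∈ range n, LeadsAt (2 * r) ((-1) ^ r) (fun x =>
      (∏ i ∈ Ico (m - r) m, (g + (x + k) - i)) * ∏ i ∈ range r, (g - (x + k) + i)) := by
    intro r hr
    have hr := mem_range.1 hr
    have h1 := LeadsAt.prod (Ico (m - r) m) (d := fun _ => 1) (c := fun _ => 1)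
      (f := fun i x => g + (x + k) - i)
      fun i _ => (LeadsAt.linear 1 (g + k - i)).congr' (.of_forall fun x => by ring)
    have h2 := LeadsAt.prod (range r) (d := fun _ => 1) (c := fun _ => -1)
      (f := fun i x => g - (x + k) + i)
      fun i _ => (LeadsAt.linear (-1) (g - k + i)).congr' (.of_forall fun x => by ring)
    have h3 := h1.mul h2
    simp only [sum_const, prod_const, Nat.card_Ico, card_range, one_pow, one_mul, nsmul_eq_mul,
      mul_one] at h3
    rwa [Nat.sub_sub_self (by omega), ← two_mul] at h3
  have h' := LeadsAt.prod (range n) h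
  rw [prod_pow_eq_pow_sum, ← mul_sum, ← Nat.cast_sum, sum_range_id_eq_choose] at h'
  exact h'

theorem leadsAt_shiftSumProd (m : ℕ) (k : ℝ) :
    LeadsAt (m.choose 2) (2 ^ m.choose 2) (fun x => shiftSumProd m (x + k)) := by
  have h := LeadsAt.prod (range m) fun j _ => LeadsAt.prod (range j)
    (d := fun _ => 1) (c := fun _ => 2) (f := fun i x => 2 * (x + k) - ((i + j : ℕ) : ℝ))
      fun i _ => (LeadsAt.linear 2 (2 * k - ((i + j : ℕ) : ℝ))).congr'
        (.of_forall fun x => by ring)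
  simp only [sum_const, prod_const, card_range, nsmul_eq_mul, mul_one] at h
  rw [prod_pow_eq_pow_sum, ← Nat.cast_sum, sum_range_id_eq_choose] at h
  exact h

theorem leadsAt_weight {n k m j : ℕ} (hm : m = n + 1 + k) (hj : j ≤ n) (g t : ℝ) :
    LeadsAt n 1 (fun x =>
      (∏ i ∈ Ico (j + 1 + k) m, (g + (x + t) - i)) * ∏ i ∈ range j, (x + t - g - i)) := by
  have h1 := LeadsAt.prod (Ico (j + 1 + k) m) (d := fun _ => 1) (c := fun _ => 1)
    (f := fun i x => g + (x + t) - i)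
    fun i _ => (LeadsAt.linear 1 (g + t - i)).congr' (.of_forall fun x => by ring)
  have h2 := LeadsAt.prod (range j) (d := fun _ => 1) (c := fun _ => 1)
    (f := fun i x => x + t - g - i)
    fun i _ => (LeadsAt.linear 1 (t - g - i)).congr' (.of_forall fun x => by ring)
  have h3 := h1.mul h2
  simp only [sum_const, prod_const, Nat.card_Ico, card_range, one_pow, nsmul_eq_mul, mul_one] at h3
  rwa [← Nat.cast_add, show m - (j + 1 + k) + j = n by omega] at h3

theorem diffLeads_weight (n k m : ℕ) (hm : m = n + 1 + k) (g t : ℝ) :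
    DiffLeads n n (2 * g - 1 - k) 1 (fun j x =>
      (∏ i ∈ Ico (j + 1 + k) m, (g + (x + t) - i)) * ∏ i ∈ range j, (x + t - g - i)) := by
  induction n generalizing k with
  | zero => simpa [DiffLeads] using leadsAt_weight hm le_rfl g t
  | succ n ih =>
    refine ⟨fun j hj => leadsAt_weight hm hj g t, ?_⟩
    have h := (ih (k + 1) (by omega)).const_mul (-(2 * g - 1 - k))
    push_cast at h ⊢
    rw [add_sub_cancel_right]
    rw [show 2 * g - 1 - (k + 1 : ℝ) = 2 * g - 1 - k - 1 by ring] at h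
    refine h.congr' fun j hj => .of_forall fun x => ?_
    beta_reduce
    rw [prod_range_succ, prod_eq_prod_Ico_succ_bot (show j + 1 + k < m by omega),
      show j + 1 + (k + 1) = j + 1 + k + 1 by ring, show j + 1 + 1 + k = j + 1 + k + 1 by ring]
    push_cast
    ring

theorem diffLeads_colWeight {m : ℕ} (hm : 0 < m) (g t : ℝ) :
    DiffLeads (m - 1) ((m - 1 : ℕ) : ℤ) (2 * g - 1) 1
      (fun j x => (-1) ^ j * colWeight m g (x + t) j) := by
  have h := diffLeads_weight (m - 1) 0 m (by omega) g t
  rw [Nat.cast_zero, sub_zero] at h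
  refine h.congr' fun j _ => .of_forall fun x => ?_
  have : ∏ i ∈ range j, (x + t - g - i) = (-1) ^ j * ∏ i ∈ range j, (g - (x + t) + i) := by
    simp_rw [show ∀ i : ℕ, x + t - g - i = -1 * (g - (x + t) + i) from fun i => by ring,
      prod_mul_distrib, prod_const, card_range]
  simp only [colWeight, this, add_zero]
  ring

/-- The sign `±1` whose powers twist row `i` of the quasi-Casorati matrix. -/
noncomputable def rowSign (E E' : Finset ℕ) (i : ℕ) : ℝ :=
  (if i ∈ E then -1 else 1) * if i ∈ E' then -1 else 1

/-- The exponent governing row `i` of the quasi-Casorati matrix. -/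
noncomputable def rowExponent (E E' : Finset ℕ) (Y : ℕ → ℝ[X]) (g g' : ℝ) (i : ℕ) : ℝ :=
  (if i ∈ E then 2 * g - 1 else 0) + (if i ∈ E' then 2 * g' - 1 else 0) + 2 * (Y i).natDegree

theorem leadsAt_det_quasiMatrix (m : ℕ) (E E' : Finset ℕ) (hE : E ⊆ range m)
    (hE' : E' ⊆ range m) (Y : ℕ → ℝ[X])
    (g g' t : ℝ) (hY : ∀ i < m, Y i ≠ 0)
    (hp : ∀ i j, i < j → j < m → rowSign E E' i = rowSign E E' j →
      rowExponent E E' Y g g' i ≠ rowExponent E E' Y g g' j) :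
    LeadsAt ((m - 1 : ℕ) * (#E + #E') + 2 * (∑ i ∈ range m, ((Y i).natDegree : ℤ)) -
        pairSum (fun i j => if rowSign E E' i = rowSign E E' j then 1 else 0) m)
      ((∏ i ∈ range m, (Y i).leadingCoeff) * pairProd (fun i j => rowSign E E' i *
        if rowSign E E' i = rowSign E E' j then
          rowExponent E E' Y g g' i - rowExponent E E' Y g g' j else -2) m)
      (fun x => (quasiMatrix m E E' Y g g' (x + t)).det) := by
  have h := leadsAt_det m (rowSign E E') (rowExponent E E' Y g g')
    (fun i => (Y i).leadingCoeff)
    (fun i => (if i ∈ E then ((m - 1 : ℕ) : ℤ) else 0) +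
      (if i ∈ E' then ((m - 1 : ℕ) : ℤ) else 0) + 2 * ((Y i).natDegree : ℤ))
    (fun i j x => (if i ∈ E then (-1) ^ j * colWeight m g (x + t) j else 1) *
      (if i ∈ E' then (-1) ^ j * colWeight m g' (x + t) j else 1) *
        (Y i).eval ((x + t - j) ^ 2)) ?_
    (fun i hi => leadingCoeff_ne_zero.2 (hY i hi)) hp ?_
  · convert h using 1
    · have hcard : ∀ E ⊆ range m, ∑ i ∈ range m, (if i ∈ E then ((m - 1 : ℕ) : ℤ) else 0) =
          (m - 1 : ℕ) * #E := by
        intro E hE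
        rw [sum_ite_mem, inter_eq_right.2 hE, sum_const, nsmul_eq_mul, mul_comm]
      simp only [sum_add_distrib, hcard E hE, hcard E' hE', ← mul_sum]
      ring
    · funext x
      congr 1
      ext i j
      simp only [quasiMatrix, rowSign, Matrix.of_apply, Polynomial.coe_aeval_eq_eval]
      split_ifs <;> rcases neg_one_pow_eq_or ℝ (j : ℕ) with h | h <;> simp [h]
  · intro i _
    simp only [rowSign]
    split_ifs <;> simp
  · intro i hi
    have hc : ∀ (F : Finset ℕ) (g : ℝ), DiffLeads (m - 1)
        (if i ∈ F then ((m - 1 : ℕ) : ℤ) else 0) (if i ∈ F then 2 * g - 1 else 0) 1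
        (fun j x => if i ∈ F then (-1) ^ j * colWeight m g (x + t) j else 1) := by
      intro F g
      split_ifs
      · exact diffLeads_colWeight (by omega) g t
      · exact DiffLeads.const _ 1
    have hsq : DiffLeads (m - 1) 2 2 1 (fun j x => (x + t - j) ^ 2) := by
      simpa using (DiffLeads.sub_natCast (m - 1) t).pow 2
    have := ((hc E g).mul (hc E' g')).mul (hsq.polynomial_eval (Y i))
    simpa only [one_mul, rowExponent] using this

theorem pch_eq_prod (k : ℕ) (z : ℝ) : pch k z = ∏ i ∈ range k, (z + i) := by
  induction k with
  | zero => simp [pch]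
  | succ k ih => rw [prod_range_succ, ← ih, pch, ascPochhammer_succ_eval, pch]

theorem prod_Ico_sub_eq_pch {m r : ℕ} (hr : r ≤ m) (y : ℝ) :
    ∏ i ∈ Ico (m - r) m, (y - i) = pch r (y - m + 1) := by
  rw [pch_eq_prod, prod_Ico_eq_prod_range, Nat.sub_sub_self hr, ← prod_range_reflect]
  refine prod_congr rfl fun l hl => ?_
  have hl := mem_range.1 hl
  rw [show m - r + (r - 1 - l) = m - (l + 1) by omega, Nat.cast_sub (by omega)]
  push_cast
  ring

theorem prod_range_add_eq_pch (y : ℝ) (j : ℕ) :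
    ∏ i ∈ range j, (y + i) = (-1) ^ j * pch j (1 - j - y) := by
  have h : (-1 : ℝ) ^ j = ∏ _i ∈ range j, -1 := by rw [prod_const, card_range]
  rw [pch_eq_prod, ← prod_range_reflect, h, ← prod_mul_distrib]
  refine prod_congr rfl fun l hl => ?_
  have hl := mem_range.1 hl
  rw [show j - 1 - l = j - (l + 1) by omega, Nat.cast_sub (by omega)]
  push_cast
  ring

theorem colWeight_eq_pch {m j : ℕ} (hj : j < m) (g s : ℝ) :
    colWeight m g s j =
      pch (m - j - 1) (g + s - m + 1) * ((-1) ^ j * pch j (1 - j - (g - s))) := by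
  rw [colWeight, prod_range_add_eq_pch, ← prod_Ico_sub_eq_pch (by omega),
    show m - (m - j - 1) = j + 1 by omega]

theorem weightDenom_eq_prod_pch {m n : ℕ} (hn : n ≤ m) (g s : ℝ) :
    weightDenom m n g s = ∏ i ∈ Icc 1 (n - 1),
      pch (n - i) (g + s - m + 1) * ((-1) ^ (n - i) * pch (n - i) (1 - (n - i : ℕ) - (g - s))) := by
  have h : weightDenom m n g s = ∏ k ∈ range n,
      pch k (g + s - m + 1) * ((-1) ^ k * pch k (1 - k - (g - s))) := by
    refine prod_congr rfl fun k hk => ?_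
    rw [prod_range_add_eq_pch, prod_Ico_sub_eq_pch ((mem_range.1 hk).le.trans hn)]
  rw [h]
  rcases n with _ | n
  · simp
  rw [prod_range_succ']
  simp only [pow_zero, pch, ascPochhammer_zero, eval_one, mul_one, add_tsub_cancel_right]
  refine prod_nbij' (fun k => n - k) (fun i => n - i) ?_ ?_ ?_ ?_ ?_ <;>
    simp only [mem_range, mem_Icc]
  any_goals intros; omega
  intro k hk
  rw [show n + 1 - (n - k) = k + 1 by omega]

theorem colWeight_eq_NN1_mul_DD1 (a b x : ℝ) {m j : ℕ} (hj : j < m) :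
    colWeight m ((b - a + 1) / 2) (x + (a + b - 1) / 2) j =
      NN1 b (m - j - 1) (x - j - 1) * DD1 a j (x - 1) := by
  rw [colWeight_eq_pch hj, NN1, DD1, Nat.sub_sub, Nat.cast_sub (by omega)]
  push_cast
  congr 2
  · ring
  · congr 2
    ring

theorem colWeight_eq_NN2_mul_DD2 (a b N x : ℝ) {m j : ℕ} (hj : j < m) :
    colWeight m (-N - (a + b + 1) / 2) (x + (a + b - 1) / 2) j =
      NN2 N (m - j - 1) (x - j - 1) * DD2 a b N j (x - 1) := by
  rw [colWeight_eq_pch hj, NN2, DD2, Nat.sub_sub, Nat.cast_sub (by omega)]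
  push_cast
  congr 2
  · ring
  · congr 2
    ring

theorem pDen_eq_weightDenom (a b N x : ℝ) (m1 m2 m3 m4 : ℕ) :
    pDen a b N m1 m2 m3 m4 x =
      weightDenom (m1 + m2 + m3 + m4) (m1 + m2) (-N - (a + b + 1) / 2) (x + (a + b - 1) / 2) *
        weightDenom (m1 + m2 + m3 + m4) (m2 + m4) ((b - a + 1) / 2) (x + (a + b - 1) / 2) := by
  rw [pDen, mul_comm, weightDenom_eq_prod_pch (by omega), weightDenom_eq_prod_pch (by omega)]
  congr 1 <;> refine prod_congr rfl fun i hi => ?_ <;> have hi := mem_Icc.1 hi <;>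
    simp only [NN1, NN2, DD1, DD2] <;> rw [Nat.cast_sub (by omega)] <;> push_cast <;>
    congr 3 <;> ring

theorem pairProd_reflect {M : Type*} [CommMonoid M] (F : ℕ → ℕ → M) (m : ℕ) :
    pairProd (fun i j => F (m - 1 - j) (m - 1 - i)) m = pairProd F m := by
  rw [pairProd, pairProd, prod_sigma', prod_sigma']
  refine prod_nbij' (fun p => ⟨m - 1 - p.2, m - 1 - p.1⟩) (fun p => ⟨m - 1 - p.2, m - 1 - p.1⟩)
    ?_ ?_ ?_ ?_ fun _ _ => rfl <;> rintro ⟨j, i⟩ <;>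
    simp only [mem_sigma, mem_range, Sigma.mk.injEq, heq_eq_eq] <;> omega

theorem qDen_eq_shiftSumProd (a b x : ℝ) (m : ℕ) :
    qDen a b m x = shiftSumProd m (x + (a + b - 1) / 2) := by
  have h : ∀ f : ℕ → ℕ → ℝ, ∏ p ∈ Icc 1 (m - 1), ∏ s ∈ Icc 1 p, f s p =
      pairProd (fun i j => f (i + 1) j) m := by
    intro f
    rw [pairProd, prod_sigma', prod_sigma']
    refine prod_nbij' (fun p => ⟨p.1, p.2 - 1⟩) (fun p => ⟨p.1, p.2 + 1⟩)
      ?_ ?_ ?_ ?_ ?_ <;> rintro ⟨j, i⟩ <;> simp only [mem_sigma, mem_range, mem_Icc,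
        Sigma.mk.injEq, heq_eq_eq, true_and] <;> intro hi
    any_goals omega
    rw [Nat.sub_add_cancel hi.2.1]
  rw [qDen, ← Nat.choose_two_right, h, ← pairProd_const, ← pairProd_mul, ← pairProd_reflect,
    shiftSumProd]
  refine pairProd_congr fun i j hij hj => ?_
  rw [Nat.sub_sub, Nat.sub_sub, Nat.cast_add (m - (1 + j)), Nat.cast_sub (by omega),
    Nat.cast_sub (by omega)]
  push_cast
  ring

theorem image_range_eq {k : ℕ} {f : ℕ → ℕ} {U : Finset ℕ} (hU : k = #U)
    (hf : StrictMonoOn f (range k)) (hfU : ∀ i < k, f i ∈ U) : (range k).image f = U := by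
  refine eq_of_subset_of_card_le (image_subset_iff.2 fun i hi => hfU i (mem_range.1 hi)) ?_
  rw [card_image_of_injOn hf.injOn, card_range, hU]

theorem vandermondeSet_image {k : ℕ} {f : ℕ → ℕ} (hf : StrictMonoOn f (range k)) :
    vandermondeSet ((range k).image f) = pairProd (fun i j => (f j : ℝ) - f i) k := by
  have hlt : ∀ i < k, ∀ j < k, (f i < f j ↔ i < j) := fun i hi j hj =>
    hf.lt_iff_lt (mem_coe.2 (mem_range.2 hi)) (mem_coe.2 (mem_range.2 hj))
  have hinj : ∀ i < k, ∀ j < k, f i = f j → i = j := fun i hi j hj h =>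
    hf.injOn (mem_coe.2 (mem_range.2 hi)) (mem_coe.2 (mem_range.2 hj)) h
  rw [vandermondeSet, pairProd, prod_sigma']
  symm
  refine prod_nbij (fun p => (f p.2, f p.1)) ?_ ?_ ?_ fun _ _ => rfl
  · rintro ⟨j, i⟩ hp
    simp only [mem_sigma, mem_range] at hp
    simp only [mem_filter, mem_product, mem_image, mem_range]
    exact ⟨⟨⟨i, hp.2.trans hp.1, rfl⟩, ⟨j, hp.1, rfl⟩⟩, (hlt i (hp.2.trans hp.1) j hp.1).2 hp.2⟩
  · rintro ⟨j, i⟩ hp ⟨j', i'⟩ hp' h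
    simp only [coe_sigma, Set.mem_sigma_iff, mem_coe, mem_range] at hp hp'
    rw [Prod.mk.injEq] at h
    obtain rfl := hinj i (hp.2.trans hp.1) i' (hp'.2.trans hp'.1) h.1
    obtain rfl := hinj j hp.1 j' hp'.1 h.2
    rfl
  · rintro ⟨y, z⟩ hp
    simp only [coe_filter, mem_product, mem_image, mem_range, Set.mem_ofPred_eq] at hp
    obtain ⟨⟨⟨i, hi, rfl⟩, ⟨j, hj, rfl⟩⟩, h⟩ := hp
    refine ⟨⟨j, i⟩, ?_, rfl⟩
    simp only [coe_sigma, Set.mem_sigma_iff, mem_coe, mem_range]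
    exact ⟨hj, (hlt i hi j hj).1 h⟩

theorem pairProd_sub_ne_zero {k : ℕ} {f : ℕ → ℕ} (hf : StrictMonoOn f (range k)) :
    pairProd (fun i j => (f j : ℝ) - f i) k ≠ 0 := by
  refine prod_ne_zero_iff.2 fun j hj => prod_ne_zero_iff.2 fun i hi => ?_
  have hi := mem_range.1 hi
  have hij : f i < f j :=
    hf (mem_coe.2 (mem_range.2 (hi.trans (mem_range.1 hj)))) (mem_coe.2 hj) hi
  exact sub_ne_zero.2 (Nat.cast_lt.2 hij).ne'

theorem pairProd_four_blocks {M : Type*} [CommMonoid M] (F : ℕ → ℕ → M) (m1 m2 m3 m4 : ℕ) :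
    pairProd F (m1 + m2 + m3 + m4) =
      pairProd F m1 * pairProd (fun i j => F (m1 + i) (m1 + j)) m2 *
      pairProd (fun i j => F (m1 + m2 + i) (m1 + m2 + j)) m3 *
      pairProd (fun i j => F (m1 + m2 + m3 + i) (m1 + m2 + m3 + j)) m4 *
      (∏ i ∈ range m1, ∏ j ∈ range m2, F i (m1 + j)) *
      (∏ i ∈ range m1, ∏ j ∈ range m3, F i (m1 + m2 + j)) *
      (∏ i ∈ range m1, ∏ j ∈ range m4, F i (m1 + m2 + m3 + j)) *
      (∏ i ∈ range m2, ∏ j ∈ range m3, F (m1 + i) (m1 + m2 + j)) *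
      (∏ i ∈ range m2, ∏ j ∈ range m4, F (m1 + i) (m1 + m2 + m3 + j)) *
      ∏ i ∈ range m3, ∏ j ∈ range m4, F (m1 + m2 + i) (m1 + m2 + m3 + j) := by
  simp only [pairProd_add, prod_range_add]
  ac_rfl

theorem pairSum_four_blocks (F : ℕ → ℕ → ℤ) (m1 m2 m3 m4 : ℕ) :
    pairSum F (m1 + m2 + m3 + m4) =
      pairSum F m1 + pairSum (fun i j => F (m1 + i) (m1 + j)) m2 +
      pairSum (fun i j => F (m1 + m2 + i) (m1 + m2 + j)) m3 +
      pairSum (fun i j => F (m1 + m2 + m3 + i) (m1 + m2 + m3 + j)) m4 +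
      (∑ i ∈ range m1, ∑ j ∈ range m2, F i (m1 + j)) +
      (∑ i ∈ range m1, ∑ j ∈ range m3, F i (m1 + m2 + j)) +
      (∑ i ∈ range m1, ∑ j ∈ range m4, F i (m1 + m2 + m3 + j)) +
      (∑ i ∈ range m2, ∑ j ∈ range m3, F (m1 + i) (m1 + m2 + j)) +
      (∑ i ∈ range m2, ∑ j ∈ range m4, F (m1 + i) (m1 + m2 + m3 + j)) +
      ∑ i ∈ range m3, ∑ j ∈ range m4, F (m1 + m2 + i) (m1 + m2 + m3 + j) := by
  simp only [pairSum_add, sum_range_add]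
  ring

section Blocks

variable {m1 m2 m3 m4 : ℕ} {l p : ℕ → ℝ} {d : ℕ → ℕ} {α β : ℝ}

theorem pairSum_sign_eq (hl1 : ∀ i < m1, l i = -1) (hl2 : ∀ i < m2, l (m1 + i) = 1)
    (hl3 : ∀ i < m3, l (m1 + m2 + i) = 1) (hl4 : ∀ i < m4, l (m1 + m2 + m3 + i) = -1) :
    pairSum (fun i j => if l i = l j then 1 else 0) (m1 + m2 + m3 + m4) =
      m1.choose 2 + m2.choose 2 + m3.choose 2 + m4.choose 2 + m1 * m4 + m2 * m3 := by
  have hdiag : ∀ (n o : ℕ) (c : ℝ), (∀ i < n, l (o + i) = c) →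
      pairSum (fun i j => if l (o + i) = l (o + j) then 1 else 0) n = n.choose 2 := by
    intro n o c hc
    rw [pairSum_congr (G := fun _ _ => 1), pairSum_const, mul_one]
    intro i j hij hj
    rw [hc i (hij.trans hj), hc j hj, if_pos rfl]
  have hoff : ∀ (n n' o o' : ℕ) (c c' : ℝ), (∀ i < n, l (o + i) = c) →
      (∀ i < n', l (o' + i) = c') →
      (∑ i ∈ range n, ∑ j ∈ range n', if l (o + i) = l (o' + j) then (1 : ℤ) else 0) =
        n * n' * if c = c' then 1 else 0 := by
    intro n n' o o' c c' hc hc'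
    rw [sum_congr rfl fun i hi => sum_congr rfl fun j hj => by
      rw [hc i (mem_range.1 hi), hc' j (mem_range.1 hj)]]
    simp
  have hl1' : ∀ i < m1, l (0 + i) = -1 := by simpa using hl1
  have h := hdiag m1 0 _ hl1'
  have h12 := hoff m1 m2 0 m1 _ _ hl1' hl2
  have h13 := hoff m1 m3 0 (m1 + m2) _ _ hl1' hl3
  have h14 := hoff m1 m4 0 (m1 + m2 + m3) _ _ hl1' hl4
  simp only [zero_add] at h h12 h13 h14
  rw [pairSum_four_blocks, h, hdiag _ _ _ hl2, hdiag _ _ _ hl3, hdiag _ _ _ hl4, h12, h13, h14,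
    hoff _ _ _ _ _ _ hl2 hl3, hoff _ _ _ _ _ _ hl2 hl4, hoff _ _ _ _ _ _ hl3 hl4]
  norm_num

theorem pairProd_blocks_eq (e c : ℝ) {F G : ℕ → ℕ → ℝ}
    (h11 : ∀ i j, i < m1 → j < m1 → F i j = c * G i j)
    (h22 : ∀ i j, i < m2 → j < m2 → F (m1 + i) (m1 + j) = e * c * G (m1 + i) (m1 + j))
    (h33 : ∀ i j, i < m3 → j < m3 →
      F (m1 + m2 + i) (m1 + m2 + j) = e * c * G (m1 + m2 + i) (m1 + m2 + j))
    (h44 : ∀ i j, i < m4 → j < m4 →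
      F (m1 + m2 + m3 + i) (m1 + m2 + m3 + j) = c * G (m1 + m2 + m3 + i) (m1 + m2 + m3 + j))
    (h12 : ∀ i j, i < m1 → j < m2 → F i (m1 + j) = c)
    (h13 : ∀ i j, i < m1 → j < m3 → F i (m1 + m2 + j) = c)
    (h14 : ∀ i j, i < m1 → j < m4 → F i (m1 + m2 + m3 + j) = c * G i (m1 + m2 + m3 + j))
    (h23 : ∀ i j, i < m2 → j < m3 →
      F (m1 + i) (m1 + m2 + j) = e * c * G (m1 + i) (m1 + m2 + j))
    (h24 : ∀ i j, i < m2 → j < m4 → F (m1 + i) (m1 + m2 + m3 + j) = e * c)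
    (h34 : ∀ i j, i < m3 → j < m4 → F (m1 + m2 + i) (m1 + m2 + m3 + j) = e * c) :
    pairProd F (m1 + m2 + m3 + m4) = c ^ (m1 + m2 + m3 + m4).choose 2 *
      e ^ (m2.choose 2 + m3.choose 2 + m2 * m3 + m2 * m4 + m3 * m4) *
      pairProd G m1 * pairProd (fun i j => G (m1 + i) (m1 + j)) m2 *
      pairProd (fun i j => G (m1 + m2 + i) (m1 + m2 + j)) m3 *
      pairProd (fun i j => G (m1 + m2 + m3 + i) (m1 + m2 + m3 + j)) m4 *
      (∏ i ∈ range m2, ∏ j ∈ range m3, G (m1 + i) (m1 + m2 + j)) *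
      ∏ i ∈ range m1, ∏ j ∈ range m4, G i (m1 + m2 + m3 + j) := by
  have hpair : ∀ (n : ℕ) (k : ℝ) (F G : ℕ → ℕ → ℝ),
      (∀ i j, i < n → j < n → F i j = k * G i j) →
      pairProd F n = k ^ n.choose 2 * pairProd G n := by
    intro n k F G h
    rw [pairProd_congr fun i j hij hj => h i j (hij.trans hj) hj, pairProd_mul, pairProd_const]
  have hrect : ∀ (n n' : ℕ) (k : ℝ) (F G : ℕ → ℕ → ℝ),
      (∀ i j, i < n → j < n' → F i j = k * G i j) →
      ∏ i ∈ range n, ∏ j ∈ range n', F i j =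
        k ^ (n * n') * ∏ i ∈ range n, ∏ j ∈ range n', G i j := by
    intro n n' k F G h
    rw [prod_congr rfl fun i hi => prod_congr rfl fun j hj =>
      h i j (mem_range.1 hi) (mem_range.1 hj)]
    simp only [prod_mul_distrib, prod_const, card_range, ← pow_mul, mul_comm n]
  have hrect' : ∀ (n n' : ℕ) (k : ℝ) (F : ℕ → ℕ → ℝ), (∀ i j, i < n → j < n' → F i j = k) →
      ∏ i ∈ range n, ∏ j ∈ range n', F i j = k ^ (n * n') := by
    intro n n' k F h
    rw [hrect n n' k F (fun _ _ => 1) fun i j hi hj => by rw [h i j hi hj, mul_one]]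
    simp
  rw [pairProd_four_blocks, hpair _ _ _ _ h11, hpair _ _ _ _ h22, hpair _ _ _ _ h33,
    hpair _ _ _ _ h44, hrect' _ _ _ _ h12, hrect' _ _ _ _ h13, hrect _ _ _ _ _ h14,
    hrect _ _ _ _ _ h23, hrect' _ _ _ _ h24, hrect' _ _ _ _ h34]
  simp only [choose_two_add]
  ring

theorem pairProd_sign_exponent_eq (hl1 : ∀ i < m1, l i = -1) (hl2 : ∀ i < m2, l (m1 + i) = 1)
    (hl3 : ∀ i < m3, l (m1 + m2 + i) = 1) (hl4 : ∀ i < m4, l (m1 + m2 + m3 + i) = -1)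
    (hp1 : ∀ i < m1, p i = α + 2 * d i) (hp2 : ∀ i < m2, p (m1 + i) = α + β + 2 * d (m1 + i))
    (hp3 : ∀ i < m3, p (m1 + m2 + i) = 2 * d (m1 + m2 + i))
    (hp4 : ∀ i < m4, p (m1 + m2 + m3 + i) = β + 2 * d (m1 + m2 + m3 + i)) :
    pairProd (fun i j => l i * if l i = l j then p i - p j else -2) (m1 + m2 + m3 + m4) =
      2 ^ (m1 + m2 + m3 + m4).choose 2 *
      (-1) ^ (m2.choose 2 + m3.choose 2 + m2 * m3 + m2 * m4 + m3 * m4) *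
      pairProd (fun i j => (d j : ℝ) - d i) m1 *
      pairProd (fun i j => (d (m1 + j) : ℝ) - d (m1 + i)) m2 *
      pairProd (fun i j => (d (m1 + m2 + j) : ℝ) - d (m1 + m2 + i)) m3 *
      pairProd (fun i j => (d (m1 + m2 + m3 + j) : ℝ) - d (m1 + m2 + m3 + i)) m4 *
      (∏ i ∈ range m2, ∏ j ∈ range m3, (-(α + β) / 2 - d (m1 + i) + d (m1 + m2 + j))) *
      ∏ i ∈ range m1, ∏ j ∈ range m4, ((β - α) / 2 - d i + d (m1 + m2 + m3 + j)) := by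
  have hF : ∀ (n n' o o' : ℕ) (e e' : ℝ), (∀ i < n, l (o + i) = e) → (∀ i < n', l (o' + i) = e') →
      ∀ i j, i < n → j < n' → (l (o + i) * if l (o + i) = l (o' + j) then
        p (o + i) - p (o' + j) else -2) = if e = e' then -e * 2 * ((p (o' + j) - p (o + i)) / 2)
          else -e * 2 := by
    intro n n' o o' e e' he he' i j hi hj
    rw [he i hi, he' j hj]
    split_ifs <;> ring
  have hl1' : ∀ i < m1, l (0 + i) = -1 := by simpa using hl1
  have h11 := hF _ _ _ _ _ _ hl1' hl1'
  have h12 := hF _ _ _ _ _ _ hl1' hl2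
  have h13 := hF _ _ _ _ _ _ hl1' hl3
  have h14 := hF _ _ _ _ _ _ hl1' hl4
  have h22 := hF _ _ _ _ _ _ hl2 hl2
  have h23 := hF _ _ _ _ _ _ hl2 hl3
  have h24 := hF _ _ _ _ _ _ hl2 hl4
  have h33 := hF _ _ _ _ _ _ hl3 hl3
  have h34 := hF _ _ _ _ _ _ hl3 hl4
  have h44 := hF _ _ _ _ _ _ hl4 hl4
  have h1 : (1 : ℝ) ≠ -1 := by norm_num
  simp only [zero_add, if_true, if_neg h1, if_neg h1.symm, neg_neg, one_mul]
    at h11 h12 h13 h14 h22 h23 h24 h33 h34 h44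
  rw [pairProd_blocks_eq (-1) 2 (G := fun i j => (p j - p i) / 2) h11 h22 h33 h44 h12 h13 h14 h23
    h24 h34]
  congr 1; congr 1; congr 1; congr 1; congr 1; congr 1
  · exact pairProd_congr fun i j hij hj => by rw [hp1 i (hij.trans hj), hp1 j hj]; ring
  · exact pairProd_congr fun i j hij hj => by rw [hp2 i (hij.trans hj), hp2 j hj]; ring
  · exact pairProd_congr fun i j hij hj => by rw [hp3 i (hij.trans hj), hp3 j hj]; ring
  · exact pairProd_congr fun i j hij hj => by rw [hp4 i (hij.trans hj), hp4 j hj]; ring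
  · exact prod_congr rfl fun i hi => prod_congr rfl fun j hj => by
      rw [hp2 i (mem_range.1 hi), hp3 j (mem_range.1 hj)]; ring
  · exact prod_congr rfl fun i hi => prod_congr rfl fun j hj => by
      rw [hp1 i (mem_range.1 hi), hp4 j (mem_range.1 hj)]; ring

end Blocks

theorem exists_polynomial_leadsAt_det {m : ℕ} {E E' : Finset ℕ} (hE : E ⊆ range m)
    (hE' : E' ⊆ range m) (Y : ℕ → ℝ[X]) (g g' t : ℝ) {d : ℤ} {c : ℝ}
    (h : LeadsAt d c (fun x => (quasiMatrix m E E' Y g g' (x + t)).det)) :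
    ∃ Q : ℝ[X], (∀ x, (quasiMatrix m E E' Y g g' (x + t)).det = Q.eval x *
      (weightDenom m #E g (x + t) * weightDenom m #E' g' (x + t) * shiftSumProd m (x + t))) ∧
      LeadsAt (d - (2 * (#E).choose 2 + 2 * (#E').choose 2 + m.choose 2))
        (c * ((-1) ^ (#E).choose 2 * (-1) ^ (#E').choose 2 * 2 ^ m.choose 2)⁻¹)
        (fun x => Q.eval x) := by
  obtain ⟨Q, hQ⟩ := exists_polynomial_det_eq hE hE' Y g g'
  refine ⟨Q.comp (X + C t), fun x => by rw [hQ]; simp, ?_⟩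
  have hcard : ∀ F ⊆ range m, #F ≤ m := fun F hF => (card_le_card hF).trans_eq (card_range m)
  have hden := ((leadsAt_weightDenom (hcard E hE) g t).mul
    (leadsAt_weightDenom (hcard E' hE') g' t)).mul (leadsAt_shiftSumProd m t)
  have hne : ((-1) ^ (#E).choose 2 * (-1) ^ (#E').choose 2 * 2 ^ m.choose 2 : ℝ) ≠ 0 := by
    positivity
  refine (h.mul (hden.inv hne)).congr' ?_
  filter_upwards [hden.eventually_ne hne] with x hx
  rw [hQ, mul_assoc, mul_inv_cancel₀ hx]
  simp

/-- Lemma 4.1: degree and leading coefficient of the quasi-Casorati determinant `P`. -/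
theorem quasiCasorati_degree_leading_coeff
    (a b N : ℝ)
    (U1 U2 U3 U4 : Finset ℕ)
    (m1 m2 m3 m4 m : ℕ)
    (hm1 : m1 = U1.card) (hm2 : m2 = U2.card) (hm3 : m3 = U3.card) (hm4 : m4 = U4.card)
    (hm : m = m1 + m2 + m3 + m4)
    -- the enumeration u of the elements of U1,…,U4 along the blocks 𝕌_1,…,𝕌_4,
    -- increasing within each block
    (u : Fin m → ℕ)
    (hu1 : ∀ i : Fin m, (i : ℕ) < m1 → u i ∈ U1)
    (hu2 : ∀ i : Fin m, m1 ≤ (i : ℕ) → (i : ℕ) < m1 + m2 → u i ∈ U2)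
    (hu3 : ∀ i : Fin m, m1 + m2 ≤ (i : ℕ) → (i : ℕ) < m1 + m2 + m3 → u i ∈ U3)
    (hu4 : ∀ i : Fin m, m1 + m2 + m3 ≤ (i : ℕ) → u i ∈ U4)
    (humono : ∀ i j : Fin m, (i : ℕ) < (j : ℕ) →
      ((j : ℕ) < m1 ∨ (m1 ≤ (i : ℕ) ∧ (j : ℕ) < m1 + m2)
        ∨ (m1 + m2 ≤ (i : ℕ) ∧ (j : ℕ) < m1 + m2 + m3) ∨ m1 + m2 + m3 ≤ (i : ℕ)) →
      u i < u j)
    -- the nonzero polynomials Y_i with deg Y_i = u_i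
    (Y : Fin m → Polynomial ℝ)
    (hYne : ∀ i, Y i ≠ 0)
    (hYdeg : ∀ i, (Y i).natDegree = u i)
    -- hypothesis (yas0)
    (hyas1 : ∀ u' ∈ U1, ∀ z ∈ U4, (z : ℝ) - (u' : ℝ) + b + N + 1 ≠ 0)
    (hyas2 : ∀ v ∈ U2, ∀ w ∈ U3, (w : ℝ) - (v : ℝ) + a + N + 1 ≠ 0) :
    -- P = det/(pq) is a polynomial of degree d with leading coefficient r
    ∃ Q : Polynomial ℝ,
      (∀ x : ℝ,
        Matrix.det (Matrix.of fun i j : Fin m =>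
          (if (i : ℕ) < m1 then
              NN2 N (m - (j : ℕ) - 1) (x - (j : ℝ) - 1) * DD2 a b N (j : ℕ) (x - 1)
            else if (i : ℕ) < m1 + m2 then
              NN1 b (m - (j : ℕ) - 1) (x - (j : ℝ) - 1) * NN2 N (m - (j : ℕ) - 1) (x - (j : ℝ) - 1) *
                DD1 a (j : ℕ) (x - 1) * DD2 a b N (j : ℕ) (x - 1)
            else if (i : ℕ) < m1 + m2 + m3 then 1
            else NN1 b (m - (j : ℕ) - 1) (x - (j : ℝ) - 1) * DD1 a (j : ℕ) (x - 1)) *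
            (Y i).eval ((x - (j : ℝ) - 1) * ((x - (j : ℝ) - 1) + a + b + 1)))
        = Q.eval x * (pDen a b N m1 m2 m3 m4 x * qDen a b m x))
      ∧ ((Q.natDegree : ℤ)
          = 2 * ((∑ v ∈ U1, (v : ℤ)) + (∑ v ∈ U2, (v : ℤ)) + (∑ v ∈ U3, (v : ℤ))
              + ∑ v ∈ U4, (v : ℤ))
            - 2 * ((Nat.choose m1 2 : ℤ) + (Nat.choose m2 2 : ℤ) + (Nat.choose m3 2 : ℤ)
              + (Nat.choose m4 2 : ℤ)))
      ∧ Q.leadingCoeff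
          = (-1 : ℝ) ^ (Nat.choose m1 2 + Nat.choose m2 2 + Nat.choose m3 2 + Nat.choose m4 2
              + m1 * m2 + m2 * m3 + m3 * m4) *
            vandermondeSet U1 * vandermondeSet U2 * vandermondeSet U3 * vandermondeSet U4 *
            (∏ i : Fin m, (Y i).leadingCoeff) *
            (∏ v ∈ U2, ∏ w ∈ U3, (N + a + 1 - (v : ℝ) + (w : ℝ))) *
            (∏ uu ∈ U1, ∏ z ∈ U4, (N + b + 1 - (uu : ℝ) + (z : ℝ))) := by
  subst hm
  set E := range (m1 + m2) with hE
  set E' := Ico m1 (m1 + m2) ∪ Ico (m1 + m2 + m3) (m1 + m2 + m3 + m4) with hE'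
  set g := -N - (a + b + 1) / 2 with hg
  set g' := (b - a + 1) / 2 with hg'
  set t := (a + b - 1) / 2 with ht
  have hEm : E ⊆ range (m1 + m2 + m3 + m4) := range_subset_range.2 (by omega)
  have hEm' : E' ⊆ range (m1 + m2 + m3 + m4) := by
    intro i hi
    simp only [hE', mem_union, mem_Ico] at hi
    exact mem_range.2 (by omega)
  have hEcard : #E = m1 + m2 := card_range _
  have hEcard' : #E' = m2 + m4 := by
    rw [hE', card_union_of_disjoint (disjoint_left.2 fun i hi hi' => by
      rw [mem_Ico] at hi hi'; omega), Nat.card_Ico, Nat.card_Ico]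
    omega
  -- the polynomials in the variable centred at the symmetry axis of `θ`
  set Z : ℕ → ℝ[X] := fun n => if h : n < m1 + m2 + m3 + m4 then
    (Y ⟨n, h⟩).comp (X - C (((a + b + 1) / 2) ^ 2)) else 0 with hZ
  have hZdeg : ∀ i (h : i < m1 + m2 + m3 + m4), (Z i).natDegree = u ⟨i, h⟩ := by
    intro i h
    simp only [hZ]
    rw [dif_pos h, natDegree_comp, natDegree_X_sub_C, mul_one, hYdeg]
  have hZlead : ∀ i : Fin (m1 + m2 + m3 + m4), (Z i).leadingCoeff = (Y i).leadingCoeff := by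
    intro i
    simp only [hZ]
    rw [dif_pos i.2, leadingCoeff_comp (by rw [natDegree_X_sub_C]; exact one_ne_zero),
      leadingCoeff_X_sub_C, one_pow, mul_one]
  have hZeval : ∀ (i : Fin (m1 + m2 + m3 + m4)) (y : ℝ),
      (Z i).eval y = (Y i).eval (y - ((a + b + 1) / 2) ^ 2) := by
    intro i y
    simp only [hZ]
    rw [dif_pos i.2]
    simp
  have hZne : ∀ i < m1 + m2 + m3 + m4, Z i ≠ 0 := by
    intro i h
    rw [← leadingCoeff_ne_zero, hZlead ⟨i, h⟩, leadingCoeff_ne_zero]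
    exact hYne _
  set d : ℕ → ℕ := fun i => (Z i).natDegree with hd
  have hmono1 : StrictMonoOn d (range m1) := by
    intro i hi j hj hij
    rw [mem_coe, mem_range] at hi hj
    simp only [hd]
    rw [hZdeg i (by omega), hZdeg j (by omega)]
    exact humono _ _ hij (by simp only; omega)
  have hmono2 : StrictMonoOn (fun i => d (m1 + i)) (range m2) := by
    intro i hi j hj hij
    rw [mem_coe, mem_range] at hi hj
    simp only [hd]
    rw [hZdeg _ (by omega), hZdeg _ (by omega)]
    exact humono _ _ (by simp only; omega) (by simp only; omega)
  have hmono3 : StrictMonoOn (fun i => d (m1 + m2 + i)) (range m3) := by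
    intro i hi j hj hij
    rw [mem_coe, mem_range] at hi hj
    simp only [hd]
    rw [hZdeg _ (by omega), hZdeg _ (by omega)]
    exact humono _ _ (by simp only; omega) (by simp only; omega)
  have hmono4 : StrictMonoOn (fun i => d (m1 + m2 + m3 + i)) (range m4) := by
    intro i hi j hj hij
    rw [mem_coe, mem_range] at hi hj
    simp only [hd]
    rw [hZdeg _ (by omega), hZdeg _ (by omega)]
    exact humono _ _ (by simp only; omega) (by simp only; omega)
  have hmem1 : ∀ i < m1, d i ∈ U1 := fun i hi => by
    simp only [hd]
    rw [hZdeg _ (by omega)]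
    exact hu1 _ hi
  have hmem2 : ∀ i < m2, d (m1 + i) ∈ U2 := fun i hi => by
    simp only [hd]
    rw [hZdeg _ (by omega)]
    exact hu2 _ (by simp only; omega) (by simp only; omega)
  have hmem3 : ∀ i < m3, d (m1 + m2 + i) ∈ U3 := fun i hi => by
    simp only [hd]
    rw [hZdeg _ (by omega)]
    exact hu3 _ (by simp only; omega) (by simp only; omega)
  have hmem4 : ∀ i < m4, d (m1 + m2 + m3 + i) ∈ U4 := fun i hi => by
    simp only [hd]
    rw [hZdeg _ (by omega)]
    exact hu4 _ (by simp only; omega)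
  have hl1 : ∀ i < m1, rowSign E E' i = -1 := fun i hi => by
    have h1 : i ∈ E := by simp only [hE, mem_range]; omega
    have h2 : i ∉ E' := by simp only [hE', mem_union, mem_Ico]; omega
    simp [rowSign, h1, h2]
  have hl2 : ∀ i < m2, rowSign E E' (m1 + i) = 1 := fun i hi => by
    have h1 : m1 + i ∈ E := by simp only [hE, mem_range]; omega
    have h2 : m1 + i ∈ E' := by simp only [hE', mem_union, mem_Ico]; omega
    simp [rowSign, h1, h2]
  have hl3 : ∀ i < m3, rowSign E E' (m1 + m2 + i) = 1 := fun i hi => by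
    have h1 : m1 + m2 + i ∉ E := by simp only [hE, mem_range]; omega
    have h2 : m1 + m2 + i ∉ E' := by simp only [hE', mem_union, mem_Ico]; omega
    simp [rowSign, h1, h2]
  have hl4 : ∀ i < m4, rowSign E E' (m1 + m2 + m3 + i) = -1 := fun i hi => by
    have h1 : m1 + m2 + m3 + i ∉ E := by simp only [hE, mem_range]; omega
    have h2 : m1 + m2 + m3 + i ∈ E' := by simp only [hE', mem_union, mem_Ico]; omega
    simp [rowSign, h1, h2]
  have hp1 : ∀ i < m1, rowExponent E E' Z g g' i = 2 * g - 1 + 2 * d i := fun i hi => by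
    have h1 : i ∈ E := by simp only [hE, mem_range]; omega
    have h2 : i ∉ E' := by simp only [hE', mem_union, mem_Ico]; omega
    simp [rowExponent, h1, h2, hd]
  have hp2 : ∀ i < m2, rowExponent E E' Z g g' (m1 + i) =
      2 * g - 1 + (2 * g' - 1) + 2 * d (m1 + i) := fun i hi => by
    have h1 : m1 + i ∈ E := by simp only [hE, mem_range]; omega
    have h2 : m1 + i ∈ E' := by simp only [hE', mem_union, mem_Ico]; omega
    simp [rowExponent, h1, h2, hd]
  have hp3 : ∀ i < m3, rowExponent E E' Z g g' (m1 + m2 + i) = 2 * d (m1 + m2 + i) :=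
    fun i hi => by
    have h1 : m1 + m2 + i ∉ E := by simp only [hE, mem_range]; omega
    have h2 : m1 + m2 + i ∉ E' := by simp only [hE', mem_union, mem_Ico]; omega
    simp [rowExponent, h1, h2, hd]
  have hp4 : ∀ i < m4, rowExponent E E' Z g g' (m1 + m2 + m3 + i) =
      2 * g' - 1 + 2 * d (m1 + m2 + m3 + i) := fun i hi => by
    have h1 : m1 + m2 + m3 + i ∉ E := by simp only [hE, mem_range]; omega
    have h2 : m1 + m2 + m3 + i ∈ E' := by simp only [hE', mem_union, mem_Ico]; omega
    simp [rowExponent, h1, h2, hd]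
  have hg23 : -(2 * g - 1 + (2 * g' - 1)) / 2 = N + a + 1 := by rw [hg, hg']; ring
  have hg14 : (2 * g' - 1 - (2 * g - 1)) / 2 = N + b + 1 := by rw [hg, hg']; ring
  have hprod := pairProd_sign_exponent_eq hl1 hl2 hl3 hl4 hp1 hp2 hp3 hp4
  have hsum := pairSum_sign_eq hl1 hl2 hl3 hl4
  rw [hg23, hg14] at hprod
  have hc : pairProd (fun i j => rowSign E E' i * if rowSign E E' i = rowSign E E' j then
      rowExponent E E' Z g g' i - rowExponent E E' Z g g' j else -2) (m1 + m2 + m3 + m4) ≠ 0 := by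
    have h23 : (∏ i ∈ range m2, ∏ j ∈ range m3,
        (N + a + 1 - d (m1 + i) + d (m1 + m2 + j))) ≠ 0 := by
      refine prod_ne_zero_iff.2 fun i hi => prod_ne_zero_iff.2 fun j hj => ?_
      convert hyas2 _ (hmem2 i (mem_range.1 hi)) _ (hmem3 j (mem_range.1 hj)) using 1
      ring
    have h14 : (∏ i ∈ range m1, ∏ j ∈ range m4,
        (N + b + 1 - d i + d (m1 + m2 + m3 + j))) ≠ 0 := by
      refine prod_ne_zero_iff.2 fun i hi => prod_ne_zero_iff.2 fun j hj => ?_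
      convert hyas1 _ (hmem1 i (mem_range.1 hi)) _ (hmem4 j (mem_range.1 hj)) using 1
      ring
    rw [hprod]
    exact mul_ne_zero (mul_ne_zero (mul_ne_zero (mul_ne_zero (mul_ne_zero (mul_ne_zero
      (by positivity) (pairProd_sub_ne_zero hmono1)) (pairProd_sub_ne_zero hmono2))
      (pairProd_sub_ne_zero hmono3)) (pairProd_sub_ne_zero hmono4)) h23) h14
  have hp : ∀ i j, i < j → j < m1 + m2 + m3 + m4 → rowSign E E' i = rowSign E E' j →
      rowExponent E E' Z g g' i ≠ rowExponent E E' Z g g' j := by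
    intro i j hij hj hs he
    refine prod_ne_zero_iff.1 (prod_ne_zero_iff.1 hc j (mem_range.2 hj)) i (mem_range.2 hij) ?_
    beta_reduce
    rw [if_pos hs, he, sub_self, mul_zero]
  obtain ⟨Q, hQ, hlim⟩ := exists_polynomial_leadsAt_det hEm hEm' Z g g' t
    (leadsAt_det_quasiMatrix _ E E' hEm hEm' Z g g' t hZne hp)
  have hlead : ∏ i ∈ range (m1 + m2 + m3 + m4), (Z i).leadingCoeff =
      ∏ i, (Y i).leadingCoeff := by
    rw [← Fin.prod_univ_eq_prod_range (fun i => (Z i).leadingCoeff)]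
    exact prod_congr rfl fun i _ => hZlead i
  obtain ⟨hdeg, hcoeff⟩ := hlim.natDegree_eq_and_leadingCoeff_eq
    (mul_ne_zero (mul_ne_zero (prod_ne_zero_iff.2 fun i hi =>
      leadingCoeff_ne_zero.2 (hZne i (mem_range.1 hi))) hc) (inv_ne_zero (by positivity)))
  rw [hlead, hprod, hEcard, hEcard'] at hcoeff
  rw [hsum, hEcard, hEcard'] at hdeg
  rw [← image_range_eq hm1 hmono1 hmem1, ← image_range_eq hm2 hmono2 hmem2,
    ← image_range_eq hm3 hmono3 hmem3, ← image_range_eq hm4 hmono4 hmem4]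
  refine ⟨Q, fun x => ?_, ?_, ?_⟩
  · rw [hEcard, hEcard'] at hQ
    rw [pDen_eq_weightDenom, qDen_eq_shiftSumProd]
    refine Eq.trans (congrArg Matrix.det ?_) (hQ x)
    ext i j
    have hi := i.2
    simp only [quasiMatrix, Matrix.of_apply, Polynomial.coe_aeval_eq_eval]
    rw [hZeval, show (x + t - (j : ℕ)) ^ 2 - ((a + b + 1) / 2) ^ 2 =
      (x - (j : ℕ) - 1) * (x - (j : ℕ) - 1 + a + b + 1) by rw [ht]; ring,
      colWeight_eq_NN1_mul_DD1 _ _ _ j.2, colWeight_eq_NN2_mul_DD2 _ _ _ _ j.2]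
    congr 1
    simp only [hE, hE', mem_union, mem_Ico, mem_range]
    split_ifs <;> first | omega | ring
  · have hchoose : ∀ n : ℕ, (2 * n.choose 2 : ℤ) = n * (n - 1) := by
      intro n
      induction n with
      | zero => simp
      | succ n ih => rw [choose_two_add]; push_cast; simp; linarith
    have hpred : ((m1 + m2 + m3 + m4 - 1 : ℕ) : ℤ) * ((m1 + m2 : ℕ) + (m2 + m4 : ℕ)) =
        (m1 + m2 + m3 + m4 - 1) * (m1 + m2 + (m2 + m4)) := by
      rcases Nat.eq_zero_or_pos (m1 + m2 + m3 + m4) with h | h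
      · obtain ⟨rfl, rfl, rfl, rfl⟩ : m1 = 0 ∧ m2 = 0 ∧ m3 = 0 ∧ m4 = 0 := by omega
        simp
      · rw [Nat.cast_sub h]
        push_cast
        ring
    rw [hdeg, hpred, sum_image hmono1.injOn, sum_image hmono2.injOn, sum_image hmono3.injOn,
      sum_image hmono4.injOn]
    simp only [sum_range_add, choose_two_add]
    push_cast
    linear_combination -hchoose m1 - 2 * hchoose m2 - hchoose m4
  · have hsign : (2 ^ (m1 + m2 + m3 + m4).choose 2 *
        (-1) ^ (m2.choose 2 + m3.choose 2 + m2 * m3 + m2 * m4 + m3 * m4) *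
        ((-1) ^ (m1 + m2).choose 2 * (-1) ^ (m2 + m4).choose 2 *
          2 ^ (m1 + m2 + m3 + m4).choose 2)⁻¹ : ℝ) =
        (-1) ^ (m1.choose 2 + m2.choose 2 + m3.choose 2 + m4.choose 2 + m1 * m2 + m2 * m3 +
          m3 * m4) := by
      have h2 : (2 : ℝ) ^ (m1 + m2 + m3 + m4).choose 2 ≠ 0 := by positivity
      rw [mul_inv, mul_comm, mul_assoc, inv_mul_cancel_left₀ h2, mul_inv, ← inv_pow, ← inv_pow,
        inv_neg_one, ← pow_add, ← pow_add, choose_two_add, choose_two_add]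
      rw [show m1.choose 2 + m2.choose 2 + m1 * m2 + (m2.choose 2 + m4.choose 2 + m2 * m4) +
        (m2.choose 2 + m3.choose 2 + m2 * m3 + m2 * m4 + m3 * m4) =
        m1.choose 2 + m2.choose 2 + m3.choose 2 + m4.choose 2 + m1 * m2 + m2 * m3 + m3 * m4 +
        2 * (m2.choose 2 + m2 * m4) by ring, pow_add _ _ (2 * _), pow_mul, neg_one_sq, one_pow,
        mul_one]
    rw [hcoeff, ← hsign, vandermondeSet_image hmono1, vandermondeSet_image hmono2,
      vandermondeSet_image hmono3, vandermondeSet_image hmono4, prod_image hmono2.injOn,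
      prod_image hmono1.injOn]
    simp only [prod_image hmono3.injOn, prod_image hmono4.injOn]
    ring
end

section
/- Let a, b, N be real numbers with a, a+b+1, a+b+N+1 ∉ {−1,−2,−3,…}. For every integer n ≥ 0, the Hahn polynomial h_n^{a,b,N} satisfies the second-order difference equation x(x−b−N−1) h_n^{a,b,N}(x−1) − [(x+a+1)(x−N) + x(x−b−N−1)] h_n^{a,b,N}(x) + (x+a+1)(x−N) h_n^{a,b,N}(x+1) = n(n+a+b+1) h_n^{a,b,N}(x), as an identity of polynomials in x. -/
open Polynomial Finset

/-- The Hahn polynomial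
`h_n^{a,b,N}(x) = Σ_{j=0}^n (−x)_j (N−n+1)_{n−j} (a+b+1)_{j+n} /
  [(2+a+b+N)_n (a+1)_j (n−j)! j!]`. -/
noncomputable def hahn (a b N : ℝ) (n : ℕ) : Polynomial ℝ :=
  ∑ j ∈ Finset.range (n + 1),
    Polynomial.C (pch (n - j) (N - (n : ℝ) + 1) * pch (j + n) (a + b + 1) /
      (pch n (2 + a + b + N) * pch j (a + 1) *
        (Nat.factorial (n - j) : ℝ) * (Nat.factorial j : ℝ))) *
      ((ascPochhammer ℝ j).comp (-Polynomial.X))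

theorem pch_succ_right (k : ℕ) (z : ℝ) : pch (k + 1) z = pch k z * (z + k) := by
  simp [pch, ascPochhammer_succ_eval]

theorem pch_succ_left (k : ℕ) (z : ℝ) : pch (k + 1) z = z * pch k (z + 1) := by
  simp [pch, ascPochhammer_succ_left]

theorem pch_ne_zero {z : ℝ} (hz : ∀ k : ℕ, z + k ≠ 0) (k : ℕ) : pch k z ≠ 0 := by
  induction k with
  | zero => simp [pch]
  | succ k ih => rw [pch_succ_right]; exact mul_ne_zero ih (hz k)

/-- The difference operator `D_{a,b,N}` acting on functions. -/
def hahnOp (a b N : ℝ) (f : ℝ → ℝ) (x : ℝ) : ℝ :=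
  x * (x - (b + N + 1)) * f (x - 1)
    - ((x + (a + 1)) * (x - N) + x * (x - (b + N + 1))) * f x
    + (x + (a + 1)) * (x - N) * f (x + 1)

theorem hahnOp_sum_mul (a b N : ℝ) (s : Finset ℕ) (c : ℕ → ℝ) (f : ℕ → ℝ → ℝ) (x : ℝ) :
    hahnOp a b N (fun y => ∑ j ∈ s, c j * f j y) x = ∑ j ∈ s, c j * hahnOp a b N (f j) x := by
  simp only [hahnOp, Finset.mul_sum, ← Finset.sum_sub_distrib, ← Finset.sum_add_distrib]
  exact Finset.sum_congr rfl fun j _ => by ring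

theorem hahnOp_pch_zero (a b N x : ℝ) : hahnOp a b N (fun y => pch 0 (-y)) x = 0 := by
  simp only [hahnOp, pch, ascPochhammer_zero, eval_one]
  ring

theorem hahnOp_pch_succ (a b N x : ℝ) (j : ℕ) :
    hahnOp a b N (fun y => pch (j + 1) (-y)) x =
      (j + 1) * (j + a + b + 2) * pch (j + 1) (-x)
        + (j + 1) * (j + 1 + a) * (N - j) * pch j (-x) := by
  have h₁ : pch (j + 1) (-(x - 1)) = pch j (-x + 1) * (-x + 1 + j) := by
    rw [pch_succ_right]; ring_nf
  have h₂ : pch (j + 1) (-(x + 1)) = (-x - 1) * pch j (-x) := by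
    rw [pch_succ_left]; ring_nf
  have h₃ : -x * pch j (-x + 1) = pch j (-x) * (-x + j) := by
    rw [← pch_succ_left, pch_succ_right]
  simp only [hahnOp, h₁, h₂, pch_succ_right j (-x)]
  linear_combination -(x - (b + N + 1)) * (-x + 1 + j) * h₃

/-- The coefficient of `(-x)_j` in `hahn a b N n`. -/
noncomputable def hahnCoeff (a b N : ℝ) (n j : ℕ) : ℝ :=
  pch (n - j) (N - (n : ℝ) + 1) * pch (j + n) (a + b + 1) /
    (pch n (2 + a + b + N) * pch j (a + 1) *
      (Nat.factorial (n - j) : ℝ) * (Nat.factorial j : ℝ))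

theorem eval_hahn (a b N x : ℝ) (n : ℕ) :
    (hahn a b N n).eval x = ∑ j ∈ Finset.range (n + 1), hahnCoeff a b N n j * pch j (-x) := by
  simp [hahn, hahnCoeff, pch, eval_finsetSum, eval_comp]

theorem hahnCoeff_succ {a b N : ℝ} (ha : ∀ k : ℕ, a + 1 + k ≠ 0) {n j : ℕ} (hj : j < n) :
    hahnCoeff a b N n (j + 1) * ((j + 1) * (j + 1 + a) * (N - j)) =
      (n - j) * (n + j + a + b + 1) * hahnCoeff a b N n j := by
  obtain ⟨m, rfl⟩ := Nat.exists_eq_add_of_lt hj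
  have hp := pch_ne_zero ha j
  have hj' := ha j
  have hm : (m : ℝ) + 1 ≠ 0 := by positivity
  have hj₁ : (j : ℝ) + 1 ≠ 0 := by positivity
  have hf := Nat.cast_ne_zero (R := ℝ).2 m.factorial_ne_zero
  have hg := Nat.cast_ne_zero (R := ℝ).2 j.factorial_ne_zero
  have e₁ : j + m + 1 - (j + 1) = m := by omega
  have e₂ : j + m + 1 - j = m + 1 := by omega
  have e₃ : j + 1 + (j + m + 1) = j + (j + m + 1) + 1 := by omega
  simp only [hahnCoeff, e₁, e₂, e₃, pch_succ_right m, pch_succ_right j,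
    pch_succ_right (j + (j + m + 1)), Nat.factorial_succ]
  generalize pch (j + m + 1) (2 + a + b + N) = q
  push_cast
  rcases eq_or_ne q 0 with rfl | hq
  · simp
  · field_simp
    ring

theorem sum_hahnCoeff_mul_hahnOp_sub {a b N : ℝ} (ha : ∀ k : ℕ, a + 1 + k ≠ 0) (x : ℝ) {n m : ℕ}
    (hm : m ≤ n) :
    ∑ j ∈ Finset.range (m + 1), hahnCoeff a b N n j *
        (hahnOp a b N (fun y => pch j (-y)) x - n * (n + a + b + 1) * pch j (-x)) =
      -((n - m) * (n + m + a + b + 1) * hahnCoeff a b N n m * pch m (-x)) := by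
  induction m with
  | zero =>
    rw [Finset.sum_range_one, hahnOp_pch_zero]
    push_cast
    ring
  | succ m ih =>
    rw [Finset.sum_range_succ, ih (by omega), hahnOp_pch_succ]
    push_cast
    linear_combination pch m (-x) * hahnCoeff_succ (b := b) (N := N) ha (show m < n by omega)

/-- The Hahn polynomials are eigenfunctions of the second-order difference operator
`D_{a,b,N}` with eigenvalue `n(n+a+b+1)`. -/
theorem hahn_second_order_difference_equation (a b N : ℝ)
    (ha : ∀ k : ℕ, a ≠ -((k : ℝ) + 1))
    (hab1 : ∀ k : ℕ, a + b + 1 ≠ -((k : ℝ) + 1))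
    (habN1 : ∀ k : ℕ, a + b + N + 1 ≠ -((k : ℝ) + 1))
    (n : ℕ) :
    Polynomial.X * (Polynomial.X - Polynomial.C (b + N + 1)) *
        (hahn a b N n).comp (Polynomial.X - 1)
      - ((Polynomial.X + Polynomial.C (a + 1)) * (Polynomial.X - Polynomial.C N)
          + Polynomial.X * (Polynomial.X - Polynomial.C (b + N + 1))) * hahn a b N n
      + (Polynomial.X + Polynomial.C (a + 1)) * (Polynomial.X - Polynomial.C N) *
        (hahn a b N n).comp (Polynomial.X + 1)
      = Polynomial.C ((n : ℝ) * ((n : ℝ) + a + b + 1)) * hahn a b N n := by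
  have ha' : ∀ k : ℕ, a + 1 + k ≠ 0 := fun k h => ha k (by linarith)
  refine Polynomial.funext fun x => ?_
  have key := sum_hahnCoeff_mul_hahnOp_sub (b := b) (N := N) ha' x le_rfl (n := n)
  simp only [mul_sub, Finset.sum_sub_distrib] at key
  rw [← hahnOp_sum_mul] at key
  simp only [mul_left_comm (hahnCoeff a b N n _), ← Finset.mul_sum, ← eval_hahn] at key
  simp only [hahnOp] at key
  simp only [eval_add, eval_sub, eval_mul, eval_comp, eval_X, eval_C, eval_one]
  linear_combination key
end

section
/- Let N be a positive integer and let a, b be real numbers with a, a+b+1, a+b+N+1 ∉ {−1,−2,−3,…}. For every integer n ≥ N+1, the polynomial (−x)_{N+1} = (−x)(−x+1)⋯(−x+N) divides the Hahn polynomial h_n^{a,b,N}(x); in particular h_n^{a,b,N}(i) = 0 for all i = 0, 1, …, N. -/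
open Polynomial Finset

/-- For a positive integer `N` and `n ≥ N+1`, the polynomial `(−x)_{N+1}` divides
the Hahn polynomial `h_n^{a,b,N}`; in particular `h_n^{a,b,N}(i) = 0` for `i = 0,…,N`. -/
theorem hahn_divisible_by_pochhammer (N : ℕ) (hN : 0 < N) (a b : ℝ)
    (ha : ∀ k : ℕ, a ≠ -((k : ℝ) + 1))
    (hab1 : ∀ k : ℕ, a + b + 1 ≠ -((k : ℝ) + 1))
    (habN1 : ∀ k : ℕ, a + b + (N : ℝ) + 1 ≠ -((k : ℝ) + 1))
    (n : ℕ) (hn : N + 1 ≤ n) :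
    ((ascPochhammer ℝ (N + 1)).comp (-Polynomial.X) ∣ hahn a b (N : ℝ) n)
      ∧ ∀ i : ℕ, i ≤ N → (hahn a b (N : ℝ) n).eval (i : ℝ) = 0 := by
  have hdvd : (ascPochhammer ℝ (N + 1)).comp (-Polynomial.X) ∣ hahn a b (N : ℝ) n := by
    refine Finset.dvd_sum fun j _ => ?_
    rcases lt_or_ge N j with hj | hj
    · obtain ⟨k, rfl⟩ := Nat.exists_eq_add_of_le (Nat.succ_le_of_lt hj)
      rw [← ascPochhammer_mul ℝ (N + 1) k, Polynomial.mul_comp]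
      exact Dvd.dvd.mul_left (dvd_mul_right _ _) _
    · have hz : (N : ℝ) - (n : ℝ) + 1 = -((n - (N + 1) : ℕ) : ℝ) := by
        rw [Nat.cast_sub hn]
        push_cast
        ring
      have h0 : pch (n - j) ((N : ℝ) - (n : ℝ) + 1) = 0 := by
        rw [hz]
        exact ascPochhammer_eval_neg_coe_nat_of_lt (by omega)
      simp [h0]
  refine ⟨hdvd, fun i hi => ?_⟩
  refine Polynomial.eval_eq_zero_of_dvd_of_eval_eq_zero hdvd ?_
  simpa using ascPochhammer_eval_neg_coe_nat_of_lt (R := ℝ) (Nat.lt_succ_of_le hi)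
end

section
/- Let N be a positive integer and let a, b be real numbers with a > −1 and b > −1. Then N! · Σ_{x=0}^{N} Γ(a+x+1)Γ(N−x+b+1) / (x!(N−x)!) = Γ(a+b+N+2)Γ(a+1)Γ(b+1) / Γ(a+b+2); that is, the total mass of the Hahn weight ρ_{a,b,N} equals Γ(a+b+N+2)Γ(a+1)Γ(b+1)/Γ(a+b+2). -/
open Finset

/-- The Chu–Vandermonde identity, written in terms of Gamma functions. -/
theorem sum_antidiagonal_choose_mul_Gamma_mul_Gamma (n : ℕ) {s t : ℝ} (hs : 0 < s) (ht : 0 < t) :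
    ∑ ij ∈ antidiagonal n,
        (n.choose ij.1 : ℝ) * (Real.Gamma (s + ij.1) * Real.Gamma (t + ij.2)) =
      Real.Gamma (s + t + n) * Real.Gamma s * Real.Gamma t / Real.Gamma (s + t) := by
  induction n generalizing s t with
  | zero =>
    have h : Real.Gamma (s + t) ≠ 0 := (Real.Gamma_pos_of_pos (add_pos hs ht)).ne'
    simp
    field_simp
  | succ n ih =>
    rw [Finset.sum_antidiagonal_choose_succ_mul
      fun i j : ℕ ↦ Real.Gamma (s + i) * Real.Gamma (t + j)]
    have h₁ := ih hs (add_pos ht one_pos)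
    have h₂ := ih (add_pos hs one_pos) ht
    have e₁ : ∑ ij ∈ antidiagonal n, (n.choose ij.1 : ℝ) *
        (Real.Gamma (s + ij.1) * Real.Gamma (t + (ij.2 + 1 : ℕ))) =
        Real.Gamma (s + (t + 1) + n) * Real.Gamma s * Real.Gamma (t + 1) /
          Real.Gamma (s + (t + 1)) := by
      rw [← h₁]
      refine sum_congr rfl fun ij _ ↦ ?_
      push_cast
      ring_nf
    have e₂ : ∑ ij ∈ antidiagonal n, (n.choose ij.2 : ℝ) *
        (Real.Gamma (s + (ij.1 + 1 : ℕ)) * Real.Gamma (t + ij.2)) =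
        Real.Gamma (s + 1 + t + n) * Real.Gamma (s + 1) * Real.Gamma t /
          Real.Gamma (s + 1 + t) := by
      rw [← h₂]
      refine sum_congr rfl fun ij hij ↦ ?_
      rw [Nat.choose_symm_of_eq_add (mem_antidiagonal.mp hij).symm]
      push_cast
      ring_nf
    have h : Real.Gamma (s + t) ≠ 0 := (Real.Gamma_pos_of_pos (add_pos hs ht)).ne'
    have hst : s + t ≠ 0 := (add_pos hs ht).ne'
    rw [e₁, e₂, show s + (t + 1) = s + t + 1 by ring, show s + 1 + t = s + t + 1 by ring,
      show s + t + ((n + 1 : ℕ) : ℝ) = s + t + 1 + n by push_cast; ring,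
      Real.Gamma_add_one hst, Real.Gamma_add_one hs.ne', Real.Gamma_add_one ht.ne']
    field_simp
    ring

/-- Total mass of the Hahn weight `ρ_{a,b,N}`:
`N! Σ_{x=0}^N Γ(a+x+1)Γ(N−x+b+1)/(x!(N−x)!) = Γ(a+b+N+2)Γ(a+1)Γ(b+1)/Γ(a+b+2)`. -/
theorem hahn_weight_total_mass (N : ℕ) (hN : 0 < N) (a b : ℝ)
    (ha : -1 < a) (hb : -1 < b) :
    (Nat.factorial N : ℝ) *
        ∑ x ∈ Finset.range (N + 1),
          Real.Gamma (a + (x : ℝ) + 1) * Real.Gamma ((N : ℝ) - (x : ℝ) + b + 1) /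
            ((Nat.factorial x : ℝ) * (Nat.factorial (N - x) : ℝ))
      = Real.Gamma (a + b + (N : ℝ) + 2) * Real.Gamma (a + 1) * Real.Gamma (b + 1) /
          Real.Gamma (a + b + 2) := by
  have key := sum_antidiagonal_choose_mul_Gamma_mul_Gamma N
    (show 0 < a + 1 by linarith) (show 0 < b + 1 by linarith)
  rw [Nat.sum_antidiagonal_eq_sum_range_succ_mk] at key
  rw [show a + b + (N : ℝ) + 2 = a + 1 + (b + 1) + N by ring,
    show a + b + 2 = a + 1 + (b + 1) by ring, ← key, mul_sum]
  refine sum_congr rfl fun x hx ↦ ?_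
  have hxN : x ≤ N := Nat.lt_succ_iff.mp (mem_range.mp hx)
  rw [Nat.cast_choose ℝ hxN, Nat.cast_sub hxN, show a + 1 + (x : ℝ) = a + x + 1 by ring,
    show b + 1 + ((N : ℝ) - x) = N - x + b + 1 by ring]
  ring
end

section
/- Let c be a real number and for a real polynomial p define ℐ^c(p)(x) = p(−(x+c+1)). If p is skew invariant, i.e. ℐ^c(p) = −p, then the linear polynomial 2x+c+1 divides p, and moreover there exists a real polynomial q such that p(x) = (2x+c+1)·q(x(x+c+1)); that is, the quotient belongs to ℝ[θ_x] where θ_x = x(x+c+1). -/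
open Polynomial

/-- The involution `ℐ^c` on `ℝ[x]`: `ℐ^c(p)(x) = p(−(x+c+1))`. -/
noncomputable def Iinv (c : ℝ) (p : Polynomial ℝ) : Polynomial ℝ :=
  p.comp (-(Polynomial.X + Polynomial.C (c + 1)))

/-- Away from characteristic two, `K[x]` is generated as a `K[x(x+a)]`-module by `1` and `2x+a`. -/
theorem exists_eq_comp_add_mul_comp {K : Type*} [Field K] (h2 : (2 : K) ≠ 0) (a : K) (p : K[X]) :
    ∃ A B : K[X], p = A.comp (X * (X + C a)) + (2 * X + C a) * B.comp (X * (X + C a)) := by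
  have hC : (C (2⁻¹ : K) : K[X]) * 2 = 1 := by
    rw [← C_ofNat, ← C_mul, inv_mul_cancel₀ h2, C_1]
  induction p using Polynomial.induction_on with
  | C r => exact ⟨C r, 0, by simp⟩
  | add p q hp hq =>
    obtain ⟨A, B, hp⟩ := hp
    obtain ⟨A', B', hq⟩ := hq
    refine ⟨A + A', B + B', ?_⟩
    simp only [add_comp]
    linear_combination hp + hq
  | monomial n r h =>
    obtain ⟨A, B, h⟩ := h
    refine ⟨C 2⁻¹ * ((4 * X + C a ^ 2) * B - C a * A), C 2⁻¹ * (A - C a * B), ?_⟩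
    simp only [mul_comp, sub_comp, add_comp, pow_comp, C_comp, X_comp, ofNat_comp]
    rw [pow_succ]
    linear_combination X * h - X * (A.comp (X * (X + C a)) +
      (2 * X + C a) * B.comp (X * (X + C a))) * hC

/-- If a real polynomial `p` is skew invariant under `ℐ^c`, i.e. `ℐ^c(p) = −p`, then
`2x+c+1` divides `p` and the quotient is a polynomial in `θ_x = x(x+c+1)`. -/
theorem Iinv_skew_invariant (c : ℝ) (p : Polynomial ℝ) (hp : Iinv c p = -p) :
    ((2 * Polynomial.X + Polynomial.C (c + 1)) ∣ p)
      ∧ ∃ q : Polynomial ℝ,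
          p = (2 * Polynomial.X + Polynomial.C (c + 1)) *
              q.comp (Polynomial.X * (Polynomial.X + Polynomial.C (c + 1))) := by
  obtain ⟨A, B, h⟩ := exists_eq_comp_add_mul_comp two_ne_zero (c + 1) p
  have hθ : (X * (X + C (c + 1))).comp (-(X + C (c + 1))) = X * (X + C (c + 1)) := by
    simp only [mul_comp, add_comp, X_comp, C_comp]
    ring
  have hI : Iinv c p = A.comp (X * (X + C (c + 1))) -
      (2 * X + C (c + 1)) * B.comp (X * (X + C (c + 1))) := by
    rw [Iinv, h, add_comp, mul_comp, comp_assoc, comp_assoc, hθ]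
    simp only [add_comp, mul_comp, X_comp, C_comp, ofNat_comp]
    ring
  have hA : A.comp (X * (X + C (c + 1))) = 0 := by
    refine (mul_eq_zero.mp ?_).resolve_left (two_ne_zero (α := ℝ[X]))
    linear_combination hp - hI - h
  rw [hA, zero_add] at h
  exact ⟨⟨_, h⟩, B, h⟩
end
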